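/- arXiv:2108.09447 — 7 statements merged into one kernel-verified Lean document; each statement's English description precedes it below -/
import Mathlib

section
/- Let u₁ = √((√5 − 1)/2). For every u ∈ [u₁, 1], γ(u) := π (2 + u² − u⁴) ( √(1 − u²) · cos(π √(1 − u²) / u²) + 2 sin(π √(1 − u²) / (2u²)) ) ≥ 0, and the inequality is strict for u ∈ [u₁, 1). -/
open Real Set

/-- `γ(u) = π (2 + u² − u⁴)(√(1−u²) cos(π√(1−u²)/u²) + 2 sin(π√(1−u²)/(2u²)))`. -/
noncomputable def gammaFn (u : ℝ) : ℝ :=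
  Real.pi * (2 + u ^ 2 - u ^ 4) *
    (Real.sqrt (1 - u ^ 2) * Real.cos (Real.pi * Real.sqrt (1 - u ^ 2) / u ^ 2) +
      2 * Real.sin (Real.pi * Real.sqrt (1 - u ^ 2) / (2 * u ^ 2)))

/-- **Key positivity for the derivative of the curvature function.**
For `u₁ = √((√5 − 1)/2)` and every `u ∈ [u₁, 1]` one has `γ(u) ≥ 0`, with strict
inequality for `u ∈ [u₁, 1)`. -/
theorem gammaFn_nonneg :
    ∀ u ∈ Set.Icc (Real.sqrt ((Real.sqrt 5 - 1) / 2)) 1,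
      0 ≤ gammaFn u ∧ (u < 1 → 0 < gammaFn u) := by
  intro u ⟨hu₁, hu⟩
  have h5 : Real.sqrt 5 ^ 2 = 5 := Real.sq_sqrt (by norm_num)
  have h5' : 1 < Real.sqrt 5 := by
    rw [Real.lt_sqrt (by norm_num)]
    norm_num
  have hu0 : 0 < u := lt_of_lt_of_le (Real.sqrt_pos.2 (by linarith)) hu₁
  have hv : (Real.sqrt 5 - 1) / 2 ≤ u ^ 2 := (Real.sqrt_le_left hu0.le).1 hu₁
  have hv0 : 0 < u ^ 2 := by positivity
  have hv1 : u ^ 2 ≤ 1 := pow_le_one₀ hu0.le hu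
  have hw_le : Real.sqrt (1 - u ^ 2) ≤ u ^ 2 := by
    rw [Real.sqrt_le_left hv0.le]
    nlinarith
  have hw_pos : u < 1 → 0 < Real.sqrt (1 - u ^ 2) := fun h =>
    Real.sqrt_pos.2 (by nlinarith)
  have hw0 : 0 ≤ Real.sqrt (1 - u ^ 2) := Real.sqrt_nonneg _
  have hfactor : 0 < Real.pi * (2 + u ^ 2 - u ^ 4) :=
    mul_pos Real.pi_pos (by nlinarith)
  unfold gammaFn
  set w := Real.sqrt (1 - u ^ 2)
  have hangle : Real.pi * w / u ^ 2 = 2 * (Real.pi * w / (2 * u ^ 2)) := by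
    field_simp
  have hsin0 : 0 ≤ Real.sin (Real.pi * w / (2 * u ^ 2)) := by
    apply Real.sin_nonneg_of_nonneg_of_le_pi
    · positivity
    · rw [div_le_iff₀ (by positivity)]
      exact mul_le_mul_of_nonneg_left (by linarith) Real.pi_pos.le
  have hsin1 := Real.sin_le_one (Real.pi * w / (2 * u ^ 2))
  rw [hangle, Real.cos_two_mul, Real.cos_sq']
  set s := Real.sin (Real.pi * w / (2 * u ^ 2))
  have hws : w * s ≤ 1 := mul_le_one₀ (hw_le.trans hv1) hsin0 hsin1
  have hbracket : w ≤ w * (2 * (1 - s ^ 2) - 1) + 2 * s := by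
    nlinarith [mul_nonneg hsin0 (sub_nonneg.2 hws)]
  exact ⟨mul_nonneg hfactor.le (hw0.trans hbracket),
    fun h => mul_pos hfactor ((hw_pos h).trans_le hbracket)⟩
end

section
/- Let t₀ = 2·arctan(√((√5 − 1)/2)). For every t ∈ (t₀, π/2], ψ(t) := sin(t/2) + √(cos t) · tan(t/2) · sin( (π/4) · √(cos t) · sin t / sin³(t/2) ) ≥ √2 / 2. -/
open Real Set

/-- `t₀ = 2 arctan √((√5 − 1)/2)`. -/
noncomputable def t0 : ℝ := 2 * Real.arctan (Real.sqrt ((Real.sqrt 5 - 1) / 2))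

/-- `ψ(t) = sin(t/2) + √(cos t)·tan(t/2)·sin((π/4)·√(cos t)·sin t / sin³(t/2))`. -/
noncomputable def psiFn (t : ℝ) : ℝ :=
  Real.sin (t / 2) + Real.sqrt (Real.cos t) * Real.tan (t / 2) *
    Real.sin (Real.pi / 4 * Real.sqrt (Real.cos t) * Real.sin t / Real.sin (t / 2) ^ 3)

/-- On `(t₀, π/2]` the half-angle tangent exceeds `√((√5 − 1)/2)`. -/
lemma sqrt_lt_tan_half {t : ℝ} (h0 : t0 < t) (ht : t ≤ π / 2) :
    √((√5 - 1) / 2) < tan (t / 2) := by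
  have hlt : arctan (√((√5 - 1) / 2)) < t / 2 := by
    unfold t0 at h0
    linarith
  have h := tan_lt_tan_of_lt_of_lt_pi_div_two (neg_pi_div_two_lt_arctan _)
    (by linarith [pi_pos]) hlt
  rwa [tan_arctan] at h

/-- With `s = sin (t/2)` and `c = cos (t/2)`, the bound `tan (t/2) > √((√5 − 1)/2)` says that
`√(cos t) · c ≤ s²`, i.e. that the argument of the inner sine in `psiFn` is at most `π/2`. -/
lemma sqrt_mul_le_sq {s c : ℝ} (hs : 0 < s) (hc : 0 < c) (hsc : s ^ 2 + c ^ 2 = 1)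
    (h : √((√5 - 1) / 2) < s / c) : √(1 - 2 * s ^ 2) * c ≤ s ^ 2 := by
  have h5 : √5 ^ 2 = 5 := sq_sqrt (by norm_num)
  have h5' : 2 < √5 := lt_sqrt_of_sq_lt (by norm_num)
  have hlt : (√5 - 1) / 2 < s ^ 2 / c ^ 2 := by
    rw [← div_pow]
    exact lt_sq_of_sqrt_lt h
  rw [lt_div_iff₀ (by positivity)] at hlt
  have hs2 : 3 - √5 < 2 * s ^ 2 := by
    have hc2 : c ^ 2 = 1 - s ^ 2 := by linarith
    rw [hc2] at hlt
    nlinarith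
  rw [← le_div_iff₀ hc]
  apply sqrt_le_iff.mpr
  refine ⟨by positivity, ?_⟩
  rw [div_pow, le_div_iff₀ (by positivity)]
  nlinarith [sq_nonneg c]

/-- **Lower bound `ψ(t) ≥ √2/2` on `(t₀, π/2]`.** -/
theorem psiFn_ge_sqrt_two_div_two :
    ∀ t ∈ Set.Ioc t0 (Real.pi / 2), Real.sqrt 2 / 2 ≤ psiFn t := by
  rintro t ⟨h0, ht⟩
  have hpos : 0 < t := by
    refine lt_of_le_of_lt ?_ h0
    have := arctan_nonneg.mpr (sqrt_nonneg ((√5 - 1) / 2))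
    unfold t0
    linarith
  have htan := sqrt_lt_tan_half h0 ht
  have hs : 0 < sin (t / 2) := sin_pos_of_pos_of_lt_pi (by linarith) (by linarith [pi_pos])
  have hc : 0 < cos (t / 2) := cos_pos_of_mem_Ioo ⟨by linarith [pi_pos], by linarith [pi_pos]⟩
  have hsc := sin_sq_add_cos_sq (t / 2)
  have hcos : cos t = 1 - 2 * sin (t / 2) ^ 2 := by
    rw [show cos t = cos (2 * (t / 2)) by ring_nf, cos_two_mul]
    linarith
  have hsin : sin t = 2 * sin (t / 2) * cos (t / 2) := by
    rw [← sin_two_mul]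
    ring_nf
  have hcos0 : 0 ≤ cos t := cos_nonneg_of_mem_Icc ⟨by linarith [pi_pos], ht⟩
  rw [tan_eq_sin_div_cos] at htan
  have hle := sqrt_mul_le_sq hs hc hsc htan
  unfold psiFn
  rw [tan_eq_sin_div_cos, hsin]
  rw [hcos] at hcos0 ⊢
  generalize sin (t / 2) = s at *
  generalize cos (t / 2) = c at *
  set r := √(1 - 2 * s ^ 2)
  have hr0 : 0 ≤ r := sqrt_nonneg _
  have hr2 : r ^ 2 = 1 - 2 * s ^ 2 := sq_sqrt hcos0
  have harg : π / 4 * r * (2 * s * c) / s ^ 3 = π / 2 * (r * c / s ^ 2) := by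
    field_simp
    ring
  have hq0 : 0 ≤ r * c / s ^ 2 := by positivity
  have hq1 : r * c / s ^ 2 ≤ 1 := (div_le_one (by positivity)).mpr hle
  have hjordan : r * c / s ^ 2 ≤ sin (π / 2 * (r * c / s ^ 2)) := by
    have h := mul_le_sin (x := π / 2 * (r * c / s ^ 2)) (by positivity)
      (mul_le_of_le_one_right (by positivity) hq1)
    rwa [← mul_assoc, div_mul_div_comm, mul_comm 2 π, div_self (by positivity), one_mul] at h
  rw [harg]
  have hs2 : s ≤ √2 / 2 := by
    rw [← pow_le_pow_iff_left₀ hs.le (by positivity) two_ne_zero]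
    rw [div_pow, sq_sqrt (by norm_num)]
    linarith
  calc √2 / 2 ≤ (1 - s ^ 2) / s := by
        rw [le_div_iff₀ hs]
        nlinarith [sq_sqrt (show (0 : ℝ) ≤ 2 by norm_num), sqrt_nonneg 2]
    _ = s + r * (s / c) * (r * c / s ^ 2) := by
        field_simp
        linarith
    _ ≤ _ := by gcongr
end

section
/- Let t₀ = 2·arctan(√((√5 − 1)/2)). (i) For every t ∈ (t₀, π/2), ψ(t) := sin(t/2) + √(cos t) · tan(t/2) · sin( (π/4) · √(cos t) · sin t / sin³(t/2) ) ≥ cos(t/2) · cot(t/2). (ii) The function ϑ(t) = cos(t/2)·cot(t/2) is strictly decreasing on (0, π/2] and ϑ(π/2) = √2/2. -/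
open Real Set

/-- `ϑ(t) = cos(t/2)·cot(t/2)`. -/
noncomputable def varthetaFn (t : ℝ) : ℝ :=
  Real.cos (t / 2) * (Real.cos (t / 2) / Real.sin (t / 2))

theorem one_le_tan_sq_add_tan_pow_four {x : ℝ} (h₁ : arctan √((√5 - 1) / 2) < x)
    (h₂ : x < π / 2) : 1 ≤ tan x ^ 2 + tan x ^ 4 := by
  have h5 : √5 ^ 2 = 5 := sq_sqrt (by norm_num)
  have h5' : 1 ≤ √5 := one_le_sqrt.2 (by norm_num)
  have hlt : √((√5 - 1) / 2) < tan x := by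
    simpa only [tan_arctan] using
      tan_lt_tan_of_lt_of_lt_pi_div_two (neg_pi_div_two_lt_arctan _) h₂ h₁
  have hsq : (√5 - 1) / 2 < tan x ^ 2 :=
    (sqrt_lt' ((sqrt_nonneg _).trans_lt hlt)).1 hlt
  nlinarith

theorem varthetaFn_le_psiFn {t : ℝ} (ht : t ∈ Ioo t0 (π / 2)) :
    varthetaFn t ≤ psiFn t := by
  obtain ⟨ht₀, htπ⟩ := ht
  have hlow : arctan √((√5 - 1) / 2) < t / 2 := by
    unfold t0 at ht₀
    linarith
  have hpos : 0 < t / 2 := (arctan_nonneg.2 (sqrt_nonneg _)).trans_lt hlow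
  have htan := one_le_tan_sq_add_tan_pow_four hlow (by linarith [pi_pos])
  have hs : 0 < sin (t / 2) := sin_pos_of_pos_of_lt_pi hpos (by linarith [pi_pos])
  have hc : 0 < cos (t / 2) := cos_pos_of_mem_Ioo ⟨by linarith, by linarith⟩
  have hcos : 0 < cos t := cos_pos_of_mem_Ioo ⟨by linarith, htπ⟩
  have hsint : sin t = 2 * sin (t / 2) * cos (t / 2) := by rw [← sin_two_mul]; ring_nf
  have hcost : cos t = cos (t / 2) ^ 2 - sin (t / 2) ^ 2 := by rw [← cos_two_mul']; ring_nf
  have hq : √(cos t) ^ 2 = cos (t / 2) ^ 2 - sin (t / 2) ^ 2 := by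
    rw [sq_sqrt hcos.le, hcost]
  rw [tan_eq_sin_div_cos] at htan
  unfold varthetaFn psiFn
  rw [hsint, tan_eq_sin_div_cos]
  have hq₀ : 0 ≤ √(cos t) := sqrt_nonneg _
  generalize √(cos t) = q at *
  generalize sin (t / 2) = s at *
  generalize cos (t / 2) = c at *
  have hle : q * c / s ^ 2 ≤ 1 := by
    rw [div_le_one (by positivity)]
    have hpoly : c ^ 4 ≤ s ^ 2 * c ^ 2 + s ^ 4 := by
      field_simp at htan
      linarith
    refine abs_le_of_sq_le_sq' ?_ (by positivity) |>.2
    rw [mul_pow, hq]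
    linarith
  have harg : π / 4 * q * (2 * s * c) / s ^ 3 = π / 2 * (q * c / s ^ 2) := by
    field_simp
    ring
  have hsin : q * c / s ^ 2 ≤ sin (π / 2 * (q * c / s ^ 2)) := by
    have h := mul_le_sin (x := π / 2 * (q * c / s ^ 2)) (by positivity)
      (mul_le_of_le_one_right (by positivity) hle)
    rwa [← mul_assoc, div_mul_div_cancel₀ pi_ne_zero, div_self two_ne_zero, one_mul] at h
  rw [harg]
  calc c * (c / s) = s + q ^ 2 / s := by rw [hq]; field_simp; ring
    _ = s + q * (s / c) * (q * c / s ^ 2) := by field_simp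
    _ ≤ _ := by gcongr

theorem varthetaFn_strictAntiOn : StrictAntiOn varthetaFn (Ioc 0 (π / 2)) := by
  rintro a ⟨ha, haπ⟩ b ⟨hb, hbπ⟩ hab
  have hsa : 0 < sin (a / 2) := sin_pos_of_pos_of_lt_pi (by linarith) (by linarith)
  have hcb : 0 < cos (b / 2) := cos_pos_of_mem_Ioo ⟨by linarith, by linarith⟩
  have hs : sin (a / 2) < sin (b / 2) :=
    sin_lt_sin_of_lt_of_le_pi_div_two (by linarith) (by linarith) (by linarith)
  have hc : cos (b / 2) < cos (a / 2) :=
    cos_lt_cos_of_nonneg_of_le_pi (by linarith) (by linarith) (by linarith)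
  have hsb := hsa.trans hs
  have hca := hcb.trans hc
  unfold varthetaFn
  gcongr

theorem varthetaFn_pi_div_two : varthetaFn (π / 2) = √2 / 2 := by
  have h : π / 2 / 2 = π / 4 := by ring
  rw [varthetaFn, h, cos_pi_div_four, sin_pi_div_four, div_self (by positivity), mul_one]

/-- **(i)** `ψ(t) ≥ ϑ(t)` on `(t₀, π/2)`; **(ii)** `ϑ` is strictly decreasing on
`(0, π/2]` and `ϑ(π/2) = √2/2`. -/
theorem psiFn_ge_varthetaFn_and_varthetaFn_strictAnti :
    (∀ t ∈ Set.Ioo t0 (Real.pi / 2), varthetaFn t ≤ psiFn t) ∧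
    StrictAntiOn varthetaFn (Set.Ioc 0 (Real.pi / 2)) ∧
    varthetaFn (Real.pi / 2) = Real.sqrt 2 / 2 := by
  exact ⟨fun _ ht => varthetaFn_le_psiFn ht, varthetaFn_strictAntiOn, varthetaFn_pi_div_two⟩
end

section
/- Let h, g be holomorphic functions on the open unit disk 𝔻 ⊂ ℂ and put f = h + conj∘g. Assume f(0) = 0, h'(0) is a positive real number, and g'(z) = z² h'(z) for all z ∈ 𝔻. Assume further that there exist sequences of holomorphic functions hₙ, gₙ, qₙ on 𝔻 such that fₙ = hₙ + conj∘gₙ is injective on 𝔻 with 𝔻 ⊆ fₙ(𝔻), gₙ'(z) = qₙ(z)² hₙ'(z) on 𝔻, fₙ(0) = 0, gₙ'(0) = 0, and fₙ → f uniformly on compact subsets of 𝔻. Then h'(0) ≥ 2√2/π. -/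
open Complex Metric Set

/-- Two of three real paths issuing from a common point must meet away from their common
starting time. -/
theorem exists_meeting_of_three_paths {δ a : ℝ} (hδ : 0 < δ) (p : Fin 3 → ℝ → ℝ)
    (hp : ∀ i, ContinuousOn (p i) (Icc 0 δ)) (ha : ∀ i, p i 0 = a) :
    ∃ i j, i ≠ j ∧ ∃ r ∈ Icc 0 δ, ∃ s ∈ Icc 0 δ, 0 < s ∧ p i r = p j s := by
  have up : ∀ i j, i ≠ j → a ≤ p i δ → a ≤ p j δ →
      ∃ i j, i ≠ j ∧ ∃ r ∈ Icc 0 δ, ∃ s ∈ Icc 0 δ, 0 < s ∧ p i r = p j s := by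
    intro i j hij hi hj
    rcases le_total (p i δ) (p j δ) with hle | hle
    · obtain ⟨r, hr, hr'⟩ := intermediate_value_Icc hδ.le (hp j) ⟨(ha j).symm ▸ hi, hle⟩
      exact ⟨j, i, hij.symm, r, hr, δ, right_mem_Icc.2 hδ.le, hδ, hr'⟩
    · obtain ⟨r, hr, hr'⟩ := intermediate_value_Icc hδ.le (hp i) ⟨(ha i).symm ▸ hj, hle⟩
      exact ⟨i, j, hij, r, hr, δ, right_mem_Icc.2 hδ.le, hδ, hr'⟩
  have down : ∀ i j, i ≠ j → p i δ ≤ a → p j δ ≤ a →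
      ∃ i j, i ≠ j ∧ ∃ r ∈ Icc 0 δ, ∃ s ∈ Icc 0 δ, 0 < s ∧ p i r = p j s := by
    intro i j hij hi hj
    rcases le_total (p i δ) (p j δ) with hle | hle
    · obtain ⟨r, hr, hr'⟩ := intermediate_value_Icc' hδ.le (hp i) ⟨hle, (ha i).symm ▸ hj⟩
      exact ⟨i, j, hij, r, hr, δ, right_mem_Icc.2 hδ.le, hδ, hr'⟩
    · obtain ⟨r, hr, hr'⟩ := intermediate_value_Icc' hδ.le (hp j) ⟨hle, (ha j).symm ▸ hi⟩
      exact ⟨j, i, hij.symm, r, hr, δ, right_mem_Icc.2 hδ.le, hδ, hr'⟩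
  rcases le_total a (p 0 δ) with h0 | h0 <;> rcases le_total a (p 1 δ) with h1 | h1 <;>
    rcases le_total a (p 2 δ) with h2 | h2 <;>
    first
    | exact up 0 1 (by decide) h0 h1
    | exact up 0 2 (by decide) h0 h2
    | exact up 1 2 (by decide) h1 h2
    | exact down 0 1 (by decide) h0 h1
    | exact down 0 2 (by decide) h0 h2
    | exact down 1 2 (by decide) h1 h2

/-- Near a critical point, a non-constant analytic function is a power of a local coordinate. -/
theorem AnalyticAt.exists_eq_add_pow_of_deriv_eq_zero {φ : ℂ → ℂ} {z₀ : ℂ}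
    (hφ : AnalyticAt ℂ φ z₀) (hd : deriv φ z₀ = 0) (hc : ¬ ∀ᶠ z in nhds z₀, φ z = φ z₀) :
    ∃ m : ℕ, 2 ≤ m ∧ ∃ η : ℂ → ℂ, AnalyticAt ℂ η z₀ ∧ η z₀ = 0 ∧ deriv η z₀ ≠ 0 ∧
      ∀ᶠ z in nhds z₀, φ z = φ z₀ + η z ^ m := by
  have hψ : AnalyticAt ℂ (fun z => φ z - φ z₀) z₀ := hφ.sub analyticAt_const
  obtain ⟨m, v, hv, hv0, hev⟩ := hψ.exists_eventuallyEq_pow_smul_nonzero_iff.2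
    (by simpa only [sub_eq_zero] using hc)
  have hm0 : m ≠ 0 := by
    rintro rfl
    have := hev.self_of_nhds
    simp at this
    exact hv0 this.symm
  have hm1 : m ≠ 1 := by
    rintro rfl
    have h1 : deriv (fun z => φ z - φ z₀) z₀ = v z₀ := by
      rw [Filter.EventuallyEq.deriv_eq hev]
      have := ((hasDerivAt_id z₀).sub_const z₀).fun_mul hv.differentiableAt.hasDerivAt
      simpa using this.deriv
    rw [deriv_sub_const, hd] at h1
    exact hv0 h1.symm
  obtain ⟨c, hcm⟩ := IsAlgClosed.exists_pow_nat_eq (v z₀) (Nat.pos_of_ne_zero hm0)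
  have hc0 : c ≠ 0 := by rintro rfl; rw [zero_pow hm0] at hcm; exact hv0 hcm.symm
  have hR : AnalyticAt ℂ (fun z => (v z / v z₀) ^ ((m : ℂ)⁻¹)) z₀ :=
    (hv.div analyticAt_const hv0).cpow analyticAt_const (by simp [div_self hv0])
  refine ⟨m, by omega, fun z => (z - z₀) * (c * (v z / v z₀) ^ ((m : ℂ)⁻¹)), ?_, by simp, ?_, ?_⟩
  · exact (analyticAt_id.sub analyticAt_const).mul (analyticAt_const.mul hR)
  · have := ((hasDerivAt_id z₀).sub_const z₀).fun_mul
      (hR.differentiableAt.hasDerivAt.const_mul c)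
    have h2 : deriv (fun z => (z - z₀) * (c * (v z / v z₀) ^ ((m : ℂ)⁻¹))) z₀ = c := by
      simpa [div_self hv0] using this.deriv
    rwa [h2]
  · filter_upwards [hev] with z hz
    rw [mul_pow, mul_pow, Complex.cpow_nat_inv_pow _ hm0, hcm, mul_div_cancel₀ _ hv0]
    rw [smul_eq_mul] at hz
    rw [← hz]; ring

theorem exp_odd_mul_pi_div_injective {m : ℕ} (hm : 2 ≤ m) :
    Function.Injective fun j : Fin 3 =>
      exp (((Real.pi * (1 + 2 * (j : ℕ)) / (2 * m) : ℝ) : ℂ) * I) := by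
  intro i j hij
  obtain ⟨n, hn⟩ := Complex.exp_eq_exp_iff_exists_int.1 hij
  have hmC : (m : ℂ) ≠ 0 := by exact_mod_cast (by omega : m ≠ 0)
  have hpi : (Real.pi : ℂ) ≠ 0 := by exact_mod_cast Real.pi_ne_zero
  push_cast at hn
  field_simp at hn
  have hn' : (1 + 2 * (i : ℕ) : ℂ) = 1 + 2 * (j : ℕ) + 4 * m * n := by
    linear_combination hn
  have h3 : (1 + 2 * (i : ℕ) : ℤ) = 1 + 2 * (j : ℕ) + 4 * m * n := by exact_mod_cast hn'
  have hi := i.2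
  have hj := j.2
  have hn0 : n = 0 := by
    by_contra hne
    have h4 : (8 : ℤ) ≤ |4 * (m : ℤ) * n| := by
      rw [abs_mul]
      have : (1 : ℤ) ≤ |n| := Int.one_le_abs hne
      have : (8 : ℤ) ≤ |4 * (m : ℤ)| := by rw [abs_of_nonneg (by positivity)]; omega
      nlinarith
    rcases le_abs.1 h4 with h | h <;> omega
  rw [hn0] at h3
  exact Fin.ext (by omega)

/-- A continuous planar map whose real part is harmonic with a critical point at `z₀`
is not injective near `z₀`. -/
theorem not_injOn_of_re_eq_of_deriv_eq_zero {φ F : ℂ → ℂ} {z₀ : ℂ} {U : Set ℂ}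
    (hU : U ∈ nhds z₀) (hF : ContinuousOn F U) (hφ : AnalyticAt ℂ φ z₀)
    (hd : deriv φ z₀ = 0) (hc : ¬ ∀ᶠ z in nhds z₀, φ z = φ z₀)
    (hre : ∀ z ∈ U, (F z).re = (φ z).re) : ¬ InjOn F U := by
  intro hinj
  obtain ⟨m, hm, η, hη, hη0, hη', hev⟩ := hφ.exists_eq_add_pow_of_deriv_eq_zero hd hc
  have hs : HasStrictFDerivAt η
      ((ContinuousLinearEquiv.unitsEquivAut ℂ (Units.mk0 _ hη') : ℂ ≃L[ℂ] ℂ) : ℂ →L[ℂ] ℂ) z₀ :=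
    hη.hasStrictDerivAt.hasStrictFDerivAt_equiv hη'
  set e := hs.toOpenPartialHomeomorph η with he
  have hz0 : z₀ ∈ e.source := hs.mem_toOpenPartialHomeomorph_source
  have hee : ∀ z, e z = η z := fun z => rfl
  have h0t : (0 : ℂ) ∈ e.target := by rw [← hη0, ← hee]; exact e.map_source hz0
  have hsymm0 : e.symm 0 = z₀ := by rw [← hη0, ← hee]; exact e.left_inv hz0
  have hN : e.target ∩ e.symm ⁻¹' (U ∩ {z | φ z = φ z₀ + η z ^ m}) ∈ nhds (0 : ℂ) := by
    refine Filter.inter_mem (e.open_target.mem_nhds h0t) ?_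
    apply (e.continuousAt_symm h0t).preimage_mem_nhds
    rw [hsymm0]
    exact Filter.inter_mem hU hev
  obtain ⟨δ, hδ, hball⟩ := Metric.nhds_basis_closedBall.mem_iff.1 hN
  set ω : Fin 3 → ℂ := fun j => exp (((Real.pi * (1 + 2 * (j : ℕ)) / (2 * m) : ℝ) : ℂ) * I)
    with hω
  have hωn : ∀ j, ‖ω j‖ = 1 := fun j => Complex.norm_exp_ofReal_mul_I _
  have hωm : ∀ j, (ω j ^ m).re = 0 := by
    intro j
    have hmC : (m : ℂ) ≠ 0 := by exact_mod_cast (by omega : m ≠ 0)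
    have : ω j ^ m = exp (((Real.pi / 2 + (j : ℕ) * Real.pi : ℝ) : ℂ) * I) := by
      rw [hω]; simp only
      rw [← Complex.exp_nat_mul]
      congr 1
      push_cast
      field_simp
    rw [this, Complex.exp_ofReal_mul_I_re, Real.cos_add_nat_mul_pi]
    simp
  have hmem : ∀ j, ∀ r ∈ Icc 0 δ, (r : ℂ) * ω j ∈ closedBall (0 : ℂ) δ := by
    intro j r hr
    rw [mem_closedBall_zero_iff, norm_mul, hωn, mul_one, Complex.norm_real, Real.norm_eq_abs,
      abs_of_nonneg hr.1]
    exact hr.2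
  have hlevel : ∀ j, ∀ r ∈ Icc 0 δ, (F (e.symm (r * ω j))).re = (φ z₀).re := by
    intro j r hr
    obtain ⟨ht, hUm, hpow⟩ := hball (hmem j r hr)
    have h1 : η (e.symm (r * ω j)) = r * ω j := by rw [← hee]; exact e.right_inv ht
    rw [hre _ hUm]
    have h2 : φ (e.symm (r * ω j)) = φ z₀ + η (e.symm (r * ω j)) ^ m := hpow
    rw [h2, h1, mul_pow, add_re, ← ofReal_pow, re_ofReal_mul, hωm, mul_zero, add_zero]
  obtain ⟨i, j, hij, r, hr, s, hs', hspos, heq⟩ := exists_meeting_of_three_paths hδ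
    (fun j r => (F (e.symm (r * ω j))).im) (a := (F z₀).im)
    (by
      intro j
      refine Complex.continuous_im.comp_continuousOn (hF.comp (e.continuousOn_symm.comp
        (by fun_prop) fun r hr => (hball (hmem j r hr)).1) fun r hr => (hball (hmem j r hr)).2.1))
    (by intro j; simp [hsymm0])
  have h1 : e.symm (r * ω i) = e.symm (s * ω j) :=
    hinj (hball (hmem i r hr)).2.1 (hball (hmem j s hs')).2.1
      (Complex.ext ((hlevel i r hr).trans (hlevel j s hs').symm) heq)
  have h2 : (r : ℂ) * ω i = s * ω j :=
    e.symm.injOn (hball (hmem i r hr)).1 (hball (hmem j s hs')).1 h1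
  have h3 : r = s := by
    have := congrArg norm h2
    simpa [norm_mul, hωn, abs_of_nonneg hr.1, abs_of_nonneg hs'.1] using this
  subst h3
  exact hij (exp_odd_mul_pi_div_injective hm
    (mul_left_cancel₀ (by exact_mod_cast hspos.ne') h2))

/-- The real derivative `v ↦ a v + conj (b v)` of a harmonic map. -/
noncomputable def harmonicFDeriv (a b : ℂ) : ℂ →L[ℝ] ℂ :=
  a • ContinuousLinearMap.id ℝ ℂ +
    (conjCLE : ℂ →L[ℝ] ℂ).comp (b • ContinuousLinearMap.id ℝ ℂ)

@[simp] theorem harmonicFDeriv_apply (a b v : ℂ) :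
    harmonicFDeriv a b v = a * v + (starRingEnd ℂ) (b * v) := by
  simp [harmonicFDeriv]

theorem hasStrictFDerivAt_add_conj {h g : ℂ → ℂ} {a b z : ℂ}
    (hh : HasStrictDerivAt h a z) (hg : HasStrictDerivAt g b z) :
    HasStrictFDerivAt (fun z => h z + (starRingEnd ℂ) (g z)) (harmonicFDeriv a b) z := by
  have h1 := hh.hasStrictFDerivAt.restrictScalars ℝ
  have h2 := (conjCLE : ℂ →L[ℝ] ℂ).hasStrictFDerivAt.comp z
    (hg.hasStrictFDerivAt.restrictScalars ℝ)
  refine (h1.add h2).congr_fderiv ?_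
  ext v
  simp [mul_comm]

theorem harmonicFDeriv_injective {a b : ℂ} (hab : ‖b‖ < ‖a‖) :
    Function.Injective (harmonicFDeriv a b) := by
  rw [injective_iff_map_eq_zero]
  intro v hv
  rw [harmonicFDeriv_apply, add_eq_zero_iff_eq_neg] at hv
  have h1 := congrArg norm hv
  rw [norm_neg, norm_mul, RCLike.norm_conj, norm_mul] at h1
  by_contra hne
  exact hab.ne' (mul_right_cancel₀ (norm_ne_zero_iff.2 hne) h1)

section FiniteDimensional

variable {E : Type*} [NormedAddCommGroup E] [NormedSpace ℝ E] [FiniteDimensional ℝ E]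

theorem HasStrictFDerivAt.exists_equiv_of_injective {F : E → E} {L : E →L[ℝ] E} {x : E}
    (hF : HasStrictFDerivAt F L x) (hL : Function.Injective L) :
    ∃ e : E ≃L[ℝ] E, HasStrictFDerivAt F (e : E →L[ℝ] E) x := by
  refine ⟨(LinearEquiv.ofInjectiveEndo (L : E →ₗ[ℝ] E) hL).toContinuousLinearEquiv, ?_⟩
  refine hF.congr_fderiv ?_
  ext v
  simp

theorem HasStrictFDerivAt.map_nhds_eq_of_injective {F : E → E} {L : E →L[ℝ] E} {x : E}
    (hF : HasStrictFDerivAt F L x) (hL : Function.Injective L) :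
    Filter.map F (nhds x) = nhds (F x) := by
  have : CompleteSpace E := FiniteDimensional.complete ℝ E
  obtain ⟨e, he⟩ := hF.exists_equiv_of_injective hL
  exact he.map_nhds_eq_of_equiv

theorem HasStrictFDerivAt.exists_injOn_of_injective {F : E → E} {L : E →L[ℝ] E} {x : E}
    (hF : HasStrictFDerivAt F L x) (hL : Function.Injective L) :
    ∃ W ∈ nhds x, InjOn F W := by
  have : CompleteSpace E := FiniteDimensional.complete ℝ E
  obtain ⟨e, he⟩ := hF.exists_equiv_of_injective hL
  exact ⟨_, (he.toOpenPartialHomeomorph F).open_source.mem_nhds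
    he.mem_toOpenPartialHomeomorph_source, (he.toOpenPartialHomeomorph F).injOn⟩

end FiniteDimensional

/-- A harmonic map with `|g'| < |h'|` pulls compact subsets of its image back to compact sets,
provided it is injective. -/
theorem isCompact_inter_preimage_of_injOn {h g : ℂ → ℂ} {U K : Set ℂ} (hU : IsOpen U)
    (hh : DifferentiableOn ℂ h U) (hg : DifferentiableOn ℂ g U)
    (hJ : ∀ z ∈ U, ‖deriv g z‖ < ‖deriv h z‖)
    (hinj : InjOn (fun z => h z + (starRingEnd ℂ) (g z)) U) (hK : IsCompact K)
    (hKf : K ⊆ (fun z => h z + (starRingEnd ℂ) (g z)) '' U) :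
    IsCompact (U ∩ (fun z => h z + (starRingEnd ℂ) (g z)) ⁻¹' K) := by
  set f : ℂ → ℂ := fun z => h z + (starRingEnd ℂ) (g z)
  have hs : ∀ z ∈ U, HasStrictFDerivAt f (harmonicFDeriv (deriv h z) (deriv g z)) z :=
    fun z hz => hasStrictFDerivAt_add_conj (hh.analyticAt (hU.mem_nhds hz)).hasStrictDerivAt
      (hg.analyticAt (hU.mem_nhds hz)).hasStrictDerivAt
  have hc : Continuous (U.domRestrict f) :=
    continuousOn_iff_continuous_domRestrict.1 fun z hz =>
      (hs z hz).continuousAt.continuousWithinAt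
  have ho : IsOpenMap (U.domRestrict f) := by
    rw [isOpenMap_iff_nhds_le]
    intro z
    have h1 := (hs z z.2).map_nhds_eq_of_injective (harmonicFDeriv_injective (hJ z z.2))
    rw [← map_nhds_subtype_coe_eq_nhds z.2 (hU.mem_nhds z.2), Filter.map_map] at h1
    exact h1.ge
  have he := Topology.IsOpenEmbedding.of_continuous_injective_isOpenMap hc
    (injOn_iff_injective.1 hinj) ho
  have h2 : IsCompact (U.domRestrict f ⁻¹' K) :=
    he.isInducing.isCompact_preimage' hK (by rwa [range_domRestrict])
  have h3 := h2.image continuous_subtype_val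
  convert h3 using 1
  ext z
  simp [and_comm]

/-- Unique solvability of `Φ s z = c` continues along a path of parameters as long as the
solutions are regular and stay in a compact set. -/
theorem solution_unique_of_continuation {Φ : ℝ → ℂ → ℂ} {U K : Set ℂ} {t : ℝ} {c : ℂ}
    (ht : 0 ≤ t) (hU : IsOpen U) (hK : IsCompact K) (hKU : K ⊆ U)
    (hcont : ∀ s : ℝ, ∀ z ∈ U, ContinuousAt (fun p : ℝ × ℂ => Φ p.1 p.2) (s, z))
    (hloc : ∀ s ∈ Icc 0 t, ∀ z ∈ U, Φ s z = c →
      ∃ W ∈ nhds (s, z), InjOn (fun p : ℝ × ℂ => (p.1, Φ p.1 p.2)) W)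
    (hmap : ∀ s ∈ Icc 0 t, ∀ z ∈ U, Φ s z = c →
      Filter.map (fun p : ℝ × ℂ => (p.1, Φ p.1 p.2)) (nhds (s, z)) = nhds (s, c))
    (hfib : ∀ s ∈ Icc 0 t, ∀ z ∈ U, Φ s z = c → z ∈ K)
    (h0 : ∀ z ∈ U, ∀ z' ∈ U, Φ 0 z = c → Φ 0 z' = c → z = z') :
    ∀ z ∈ U, ∀ z' ∈ U, Φ t z = c → Φ t z' = c → z = z' := by
  set S : Set ℝ := {s | ∀ z ∈ U, ∀ z' ∈ U, Φ s z = c → Φ s z' = c → z = z'} with hS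
  suffices Icc 0 t ⊆ S from this (right_mem_Icc.2 ht)
  refine IsClosed.Icc_subset_of_forall_mem_nhdsWithin ?_ h0 ?_
  · refine isClosed_of_closure_subset fun s hs => ?_
    have hsI : s ∈ Icc 0 t := by
      simpa using closure_mono (inter_subset_right : S ∩ Icc 0 t ⊆ _) hs
    refine ⟨?_, hsI⟩
    by_contra hsS
    simp only [hS, mem_ofPred_eq, not_forall] at hsS
    obtain ⟨z, hz, z', hz', h1, h2, hne⟩ := hsS
    obtain ⟨V, V', hV, hV', hd⟩ := t2_separation_nhds hne
    have key : ∀ w ∈ U, Φ s w = c → ∀ V ∈ nhds w, ∀ᶠ s' in nhds s, ∃ y ∈ V ∩ U, Φ s' y = c := by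
      intro w hw hwc V hV
      have h3 : (univ : Set ℝ) ×ˢ (V ∩ U) ∈ nhds (s, w) :=
        prod_mem_nhds Filter.univ_mem (Filter.inter_mem hV (hU.mem_nhds hw))
      have h4 := Filter.image_mem_map (m := fun p : ℝ × ℂ => (p.1, Φ p.1 p.2)) h3
      rw [hmap s hsI w hw hwc] at h4
      have h5 : ContinuousAt (fun s' : ℝ => (s', c)) s := by fun_prop
      filter_upwards [h5.preimage_mem_nhds h4] with s' hs'
      obtain ⟨⟨s'', y⟩, hy, hy'⟩ := hs'
      simp only [Prod.mk.injEq] at hy'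
      obtain ⟨rfl, hy'⟩ := hy'
      exact ⟨y, hy.2, hy'⟩
    obtain ⟨s', hs', ⟨y, hy, hyc⟩, y', hy', hyc'⟩ :=
      ((mem_closure_iff_frequently.1 hs).and_eventually
        ((key z hz h1 V hV).and (key z' hz' h2 V' hV'))).exists
    exact disjoint_left.1 hd hy.1 (hs'.1 y hy.2 y' hy'.2 hyc hyc' ▸ hy'.1)
  · rintro s ⟨hsS, hs0, hst⟩
    by_contra hnot
    have hfreq : ∃ᶠ s' in nhdsWithin s (Ioi s), s' ∉ S := fun hev =>
      hnot (hev.mono fun _ => not_not.1)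
    have hfreq' := hfreq.and_eventually (Ioc_mem_nhdsGT hst)
    obtain ⟨σ, hσ, hσS⟩ := Filter.exists_seq_forall_of_frequently hfreq'
    have hσs : Filter.Tendsto σ Filter.atTop (nhds s) := hσ.mono_right nhdsWithin_le_nhds
    have hex : ∀ n, ∃ p : ℂ × ℂ, p.1 ∈ U ∧ p.2 ∈ U ∧ Φ (σ n) p.1 = c ∧ Φ (σ n) p.2 = c ∧
        p.1 ≠ p.2 := by
      intro n
      have := (hσS n).1
      simp only [hS, mem_ofPred_eq, not_forall] at this
      obtain ⟨z, hz, z', hz', h1, h2, hne⟩ := this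
      exact ⟨(z, z'), hz, hz', h1, h2, hne⟩
    choose p hp1 hp2 hpc1 hpc2 hpne using hex
    have hσI : ∀ n, σ n ∈ Icc 0 t := fun n => ⟨hs0.trans (hσS n).2.1.le, (hσS n).2.2⟩
    obtain ⟨⟨w, w'⟩, ⟨hw, hw'⟩, ν, hν, hlim⟩ := (hK.prod hK).tendsto_subseq (x := p)
      fun n => ⟨hfib _ (hσI n) _ (hp1 n) (hpc1 n), hfib _ (hσI n) _ (hp2 n) (hpc2 n)⟩
    have hσν := hσs.comp hν.tendsto_atTop
    have hl1 : Filter.Tendsto (fun n => ((σ ∘ ν) n, (p (ν n)).1)) Filter.atTop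
        (nhds (s, w)) := hσν.prodMk_nhds ((continuous_fst.tendsto _).comp hlim)
    have hl2 : Filter.Tendsto (fun n => ((σ ∘ ν) n, (p (ν n)).2)) Filter.atTop
        (nhds (s, w')) := hσν.prodMk_nhds ((continuous_snd.tendsto _).comp hlim)
    have hc1 : Φ s w = c := by
      refine tendsto_nhds_unique ((hcont s w (hKU hw)).tendsto.comp hl1) ?_
      simp [Function.comp_def, hpc1]
    have hc2 : Φ s w' = c := by
      refine tendsto_nhds_unique ((hcont s w' (hKU hw')).tendsto.comp hl2) ?_
      simp [Function.comp_def, hpc2]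
    obtain rfl : w = w' := hsS w (hKU hw) w' (hKU hw') hc1 hc2
    obtain ⟨W, hW, hWinj⟩ := hloc s ⟨hs0, hst.le⟩ w (hKU hw) hc1
    obtain ⟨n, hn1, hn2⟩ := ((hl1.eventually_mem hW).and (hl2.eventually_mem hW)).exists
    have := hWinj hn1 hn2 (by simp [hpc1, hpc2])
    simp only [Prod.mk.injEq, true_and] at this
    exact hpne _ this

theorem det_smulRight_eq_zero (ρ : ℂ →L[ℝ] ℝ) (c : ℂ) : (ρ.smulRight c).det = 0 := by
  rw [ContinuousLinearMap.det, LinearMap.det_eq_zero_iff_ker_ne_bot]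
  intro hker
  rw [LinearMap.ker_eq_bot'] at hker
  have h1 : ((ρ I : ℂ) - ρ 1 * I) = 0 := hker _ (by
    have : ρ ((ρ I : ℂ) - ρ 1 * I) = 0 := by
      have e : ((ρ I : ℂ) - ρ 1 * I) = (ρ I) • (1 : ℂ) - (ρ 1) • I := by simp
      rw [e, map_sub, map_smul, map_smul]; simp [mul_comm]
    simp [this])
  have h2 : ρ 1 = 0 := by simpa using congrArg im h1
  exact one_ne_zero (hker 1 (by simp [h2]))

/-- For two harmonic maps with the same second Beltrami coefficient, the critical values of all
the differences `f - s • κ`, `s ∈ ℝ`, form a null set. -/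
theorem volume_critical_values_eq_zero {h g k l ω : ℂ → ℂ} {U : Set ℂ} (hU : IsOpen U)
    (hh : DifferentiableOn ℂ h U) (hg : DifferentiableOn ℂ g U)
    (hk : DifferentiableOn ℂ k U) (hl : DifferentiableOn ℂ l U)
    (hgω : ∀ z ∈ U, deriv g z = ω z * deriv h z) (hlω : ∀ z ∈ U, deriv l z = ω z * deriv k z) :
    MeasureTheory.volume {c : ℂ | ∃ s : ℝ, ∃ z ∈ U, deriv h z ≠ 0 ∧ deriv h z = s * deriv k z ∧
      h z + (starRingEnd ℂ) (g z) - s * (k z + (starRingEnd ℂ) (l z)) = c} = 0 := by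
  set ρ : ℂ → ℝ := fun z => (deriv h z / deriv k z).re with hρ
  set A : Set ℂ := {z | z ∈ U ∧ deriv k z ≠ 0 ∧ deriv h z = ρ z * deriv k z} with hA
  set κ : ℂ → ℂ := fun z => k z + (starRingEnd ℂ) (l z) with hκ
  set Φ : ℂ → ℂ := fun z => h z + (starRingEnd ℂ) (g z) - ρ z • κ z with hΦ
  have hρd : ∀ z ∈ A, DifferentiableAt ℝ ρ z := by
    rintro z ⟨hz, hkz, -⟩
    have h1 : DifferentiableAt ℂ (fun z => deriv h z / deriv k z) z :=
      (hh.analyticAt (hU.mem_nhds hz)).deriv.differentiableAt.fun_div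
        (hk.analyticAt (hU.mem_nhds hz)).deriv.differentiableAt hkz
    exact reCLM.differentiableAt.comp z (h1.restrictScalars ℝ)
  have hder : ∀ z ∈ A, HasFDerivWithinAt Φ ((-fderiv ℝ ρ z).smulRight (κ z)) A z := by
    intro z hzA
    have hρz := (hρd z hzA).hasFDerivAt
    obtain ⟨hz, hkz, hhk⟩ := hzA
    have h1 := (hasStrictFDerivAt_add_conj
      (hh.analyticAt (hU.mem_nhds hz)).hasStrictDerivAt
      (hg.analyticAt (hU.mem_nhds hz)).hasStrictDerivAt).hasFDerivAt
    have h2 := (hasStrictFDerivAt_add_conj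
      (hk.analyticAt (hU.mem_nhds hz)).hasStrictDerivAt
      (hl.analyticAt (hU.mem_nhds hz)).hasStrictDerivAt).hasFDerivAt
    have h3 := h1.sub (hρz.fun_smul h2)
    refine (h3.congr_fderiv ?_).hasFDerivWithinAt
    refine ContinuousLinearMap.ext fun v => ?_
    simp only [_root_.sub_apply, _root_.add_apply,
      _root_.smul_apply, ContinuousLinearMap.smulRight_apply,
      _root_.neg_apply, harmonicFDeriv_apply, hgω z hz, hlω z hz]
    rw [hhk]
    simp only [real_smul, map_mul, conj_ofReal, hκ]
    push_cast
    ring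
  refine MeasureTheory.measure_mono_null ?_
    (MeasureTheory.addHaar_image_eq_zero_of_det_fderivWithin_eq_zero MeasureTheory.volume
      hder fun z _ => det_smulRight_eq_zero _ _)
  rintro c ⟨s, z, hz, hne, heq, rfl⟩
  have hkz : deriv k z ≠ 0 := fun h0 => hne (by rw [heq, h0, mul_zero])
  have hs : ρ z = s := by simp [hρ, heq, mul_div_cancel_right₀ _ hkz]
  exact ⟨z, ⟨hz, hkz, by rw [hs]; exact heq⟩, by simp [hΦ, hs, hκ, mul_add]⟩

/-- A value that is regular for all the differences `f - s • κ`, `0 ≤ s ≤ t`, is attained by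
`f - t • κ` at most once. -/
theorem sub_mul_eq_unique_of_regular {h g k l ω : ℂ → ℂ} {t : ℝ} {c : ℂ}
    (hh : DifferentiableOn ℂ h (ball 0 1)) (hg : DifferentiableOn ℂ g (ball 0 1))
    (hk : DifferentiableOn ℂ k (ball 0 1)) (hl : DifferentiableOn ℂ l (ball 0 1))
    (hgω : ∀ z ∈ ball (0 : ℂ) 1, deriv g z = ω z * deriv h z)
    (hlω : ∀ z ∈ ball (0 : ℂ) 1, deriv l z = ω z * deriv k z)
    (hω : ∀ z ∈ ball (0 : ℂ) 1, ‖ω z‖ < 1) (hh0 : ∀ z ∈ ball (0 : ℂ) 1, deriv h z ≠ 0)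
    (hinj : InjOn (fun z => h z + (starRingEnd ℂ) (g z)) (ball 0 1))
    (hcov : ball (0 : ℂ) 1 ⊆ (fun z => h z + (starRingEnd ℂ) (g z)) '' ball 0 1)
    (hκ : ∀ z ∈ ball (0 : ℂ) 1, ‖k z + (starRingEnd ℂ) (l z)‖ ≤ 1)
    (ht : 0 ≤ t) (hct : ‖c‖ + t < 1)
    (hreg : ∀ s ∈ Icc 0 t, ∀ z ∈ ball (0 : ℂ) 1,
      h z + (starRingEnd ℂ) (g z) - s * (k z + (starRingEnd ℂ) (l z)) = c →
        deriv h z ≠ s * deriv k z) :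
    ∀ z ∈ ball (0 : ℂ) 1, ∀ z' ∈ ball (0 : ℂ) 1,
      h z + (starRingEnd ℂ) (g z) - t * (k z + (starRingEnd ℂ) (l z)) = c →
      h z' + (starRingEnd ℂ) (g z') - t * (k z' + (starRingEnd ℂ) (l z')) = c → z = z' := by
  have hd : ∀ s : ℝ, ∀ z ∈ ball (0 : ℂ) 1, ∃ L : ℝ × ℂ →L[ℝ] ℂ,
      HasStrictFDerivAt (fun p : ℝ × ℂ => h p.2 + (starRingEnd ℂ) (g p.2) -
        p.1 * (k p.2 + (starRingEnd ℂ) (l p.2))) L (s, z) ∧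
      ∀ v : ℂ, L (0, v) = harmonicFDeriv (deriv h z - s * deriv k z)
        (deriv g z - s * deriv l z) v := by
    intro s z hz
    have h1 := (hasStrictFDerivAt_add_conj
      (hh.analyticAt (isOpen_ball.mem_nhds hz)).hasStrictDerivAt
      (hg.analyticAt (isOpen_ball.mem_nhds hz)).hasStrictDerivAt).comp (s, z)
        (hasStrictFDerivAt_snd (𝕜 := ℝ))
    have h2 := (hasStrictFDerivAt_add_conj
      (hk.analyticAt (isOpen_ball.mem_nhds hz)).hasStrictDerivAt
      (hl.analyticAt (isOpen_ball.mem_nhds hz)).hasStrictDerivAt).comp (s, z)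
        (hasStrictFDerivAt_snd (𝕜 := ℝ))
    have h3 := h1.sub ((hasStrictFDerivAt_fst (𝕜 := ℝ) (p := (s, z))).smul h2)
    refine ⟨_, h3, fun v => ?_⟩
    simp
    ring
  have hJ : ∀ z ∈ ball (0 : ℂ) 1, ∀ s : ℝ, deriv h z ≠ s * deriv k z →
      ‖deriv g z - s * deriv l z‖ < ‖deriv h z - s * deriv k z‖ := by
    intro z hz s hs
    have : deriv g z - s * deriv l z = ω z * (deriv h z - s * deriv k z) := by
      rw [hgω z hz, hlω z hz]; ring
    rw [this, norm_mul]
    exact mul_lt_of_lt_one_left (norm_pos_iff.2 (sub_ne_zero.2 hs)) (hω z hz)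
  have hfull : ∀ s ∈ Icc 0 t, ∀ z ∈ ball (0 : ℂ) 1,
      h z + (starRingEnd ℂ) (g z) - s * (k z + (starRingEnd ℂ) (l z)) = c →
      ∃ L : ℝ × ℂ →L[ℝ] ℝ × ℂ, Function.Injective L ∧
        HasStrictFDerivAt (fun p : ℝ × ℂ => (p.1, h p.2 + (starRingEnd ℂ) (g p.2) -
        p.1 * (k p.2 + (starRingEnd ℂ) (l p.2)))) L (s, z) := by
    intro s hs z hz hc
    obtain ⟨L, hL, hL0⟩ := hd s z hz
    refine ⟨_, ?_, (hasStrictFDerivAt_fst (𝕜 := ℝ) (p := (s, z))).prodMk hL⟩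
    rw [injective_iff_map_eq_zero]
    rintro ⟨σ, v⟩ hv
    simp only [ContinuousLinearMap.prod_apply, Prod.mk_eq_zero, ContinuousLinearMap.coe_fst'] at hv
    obtain ⟨rfl, hv⟩ := hv
    rw [hL0] at hv
    have := (injective_iff_map_eq_zero _).1
      (harmonicFDeriv_injective (hJ z hz s (hreg s hs z hz hc))) v hv
    simp [this]
  have hJ0 : ∀ z ∈ ball (0 : ℂ) 1, ‖deriv g z‖ < ‖deriv h z‖ := fun z hz => by
    simpa using hJ z hz 0 (by simpa using hh0 z hz)
  have hK := isCompact_inter_preimage_of_injOn isOpen_ball hh hg hJ0 hinj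
    (isCompact_closedBall (0 : ℂ) (‖c‖ + t)) ((closedBall_subset_ball hct).trans hcov)
  refine solution_unique_of_continuation
    (Φ := fun s z => h z + (starRingEnd ℂ) (g z) - s * (k z + (starRingEnd ℂ) (l z)))
    ht isOpen_ball hK inter_subset_left ?_ ?_ ?_ ?_ ?_
  · intro s z hz
    obtain ⟨L, hL, -⟩ := hd s z hz
    exact hL.continuousAt
  · intro s hs z hz hc
    obtain ⟨L, hL, hL'⟩ := hfull s hs z hz hc
    exact hL'.exists_injOn_of_injective hL
  · intro s hs z hz hc
    obtain ⟨L, hL, hL'⟩ := hfull s hs z hz hc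
    rw [hL'.map_nhds_eq_of_injective hL]
    simp only [hc]
  · intro s hs z hz hc
    refine ⟨hz, ?_⟩
    rw [mem_preimage, mem_closedBall_zero_iff]
    calc ‖h z + (starRingEnd ℂ) (g z)‖ = ‖c + s * (k z + (starRingEnd ℂ) (l z))‖ := by
          rw [← hc]; congr 1; ring
      _ ≤ ‖c‖ + s * ‖k z + (starRingEnd ℂ) (l z)‖ := by
          refine (norm_add_le _ _).trans_eq ?_
          rw [norm_mul, Complex.norm_real, Real.norm_of_nonneg hs.1]
      _ ≤ ‖c‖ + t := by
          have := mul_le_mul hs.2 (hκ z hz) (norm_nonneg _) ht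
          linarith
  · intro z hz z' hz' h1 h2
    exact hinj hz hz' (by simpa using h1.trans h2.symm)

/-- **Lewy's theorem** for harmonic maps of the disk covering the disk. -/
theorem norm_deriv_ne_of_injOn {h g : ℂ → ℂ}
    (hh : DifferentiableOn ℂ h (ball 0 1)) (hg : DifferentiableOn ℂ g (ball 0 1))
    (hinj : InjOn (fun z => h z + (starRingEnd ℂ) (g z)) (ball 0 1))
    (hcov : ball (0 : ℂ) 1 ⊆ (fun z => h z + (starRingEnd ℂ) (g z)) '' ball 0 1)
    {z : ℂ} (hz : z ∈ ball (0 : ℂ) 1) : ‖deriv g z‖ ≠ ‖deriv h z‖ := by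
  intro heq
  obtain ⟨μ, hμ, hμd⟩ : ∃ μ : ℂ, ‖μ‖ = 1 ∧
      μ * deriv h z + (starRingEnd ℂ) μ * deriv g z = 0 := by
    by_cases h0 : deriv h z = 0
    · have : deriv g z = 0 := by rwa [h0, norm_zero, norm_eq_zero] at heq
      exact ⟨1, by simp, by simp [h0, this]⟩
    · obtain ⟨μ, hμ2⟩ := IsAlgClosed.exists_pow_nat_eq (-(deriv g z / deriv h z)) two_pos
      have hn : ‖μ‖ = 1 := by
        have := congrArg norm hμ2
        rw [norm_neg, norm_div, heq, div_self (norm_ne_zero_iff.2 h0), norm_pow] at this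
        exact (pow_eq_one_iff_of_nonneg (norm_nonneg _) two_ne_zero).1 this
      refine ⟨μ, hn, ?_⟩
      have hc : (starRingEnd ℂ) μ * μ = 1 := by
        rw [mul_comm, Complex.mul_conj, Complex.normSq_eq_norm_sq, hn]; simp
      have hg' : deriv g z = -(μ ^ 2 * deriv h z) := by
        rw [hμ2]; field_simp
      rw [hg']
      linear_combination (-μ * deriv h z) * hc
  have hμ1 : μ * (starRingEnd ℂ) μ = 1 := by
    rw [Complex.mul_conj, Complex.normSq_eq_norm_sq, hμ]; simp
  have hμ0 : μ ≠ 0 := fun h0 => by simp [h0] at hμ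
  set φ : ℂ → ℂ := fun z => μ * h z + (starRingEnd ℂ) μ * g z with hφ
  have hφd : DifferentiableOn ℂ φ (ball 0 1) := (hh.const_mul _).add (hg.const_mul _)
  have hre : ∀ z, (μ * (h z + (starRingEnd ℂ) (g z))).re = (φ z).re := by
    intro z
    simp [hφ]
    ring
  have hzn := isOpen_ball.mem_nhds hz
  refine not_injOn_of_re_eq_of_deriv_eq_zero (φ := φ)
    (F := fun z => μ * (h z + (starRingEnd ℂ) (g z))) hzn ?_ (hφd.analyticAt hzn) ?_ ?_
    (fun z _ => hre z) ?_
  · exact continuousOn_const.mul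
      (hh.continuousOn.add (continuous_conj.comp_continuousOn hg.continuousOn))
  · exact ((((hh.differentiableAt hzn).hasDerivAt.const_mul μ).add
      ((hg.differentiableAt hzn).hasDerivAt.const_mul _)).deriv).trans hμd
  · intro hconst
    have hEq := (hφd.analyticOnNhd isOpen_ball).eqOn_of_preconnected_of_eventuallyEq
      (analyticOnNhd_const (v := φ z)) (convex_ball _ _).isPreconnected hz hconst
    obtain ⟨a, ha, ha'⟩ := hcov (show (0 : ℂ) ∈ ball (0 : ℂ) 1 by simp)
    obtain ⟨b, hb, hb'⟩ := hcov (show (starRingEnd ℂ) μ / 2 ∈ ball (0 : ℂ) 1 by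
      simp [hμ]; norm_num)
    have ea := hre a
    have eb := hre b
    simp only at ha' hb'
    rw [hEq ha, ha'] at ea
    rw [hEq hb, hb', ← mul_div_assoc, hμ1, ← ea] at eb
    norm_num at eb
  · intro a ha b hb hab
    exact hinj ha hb (mul_left_cancel₀ hμ0 hab)

theorem norm_beltrami_lt_one_and_deriv_ne_zero {h g ω : ℂ → ℂ}
    (hh : DifferentiableOn ℂ h (ball 0 1)) (hg : DifferentiableOn ℂ g (ball 0 1))
    (hω : ContinuousOn ω (ball 0 1))
    (hinj : InjOn (fun z => h z + (starRingEnd ℂ) (g z)) (ball 0 1))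
    (hcov : ball (0 : ℂ) 1 ⊆ (fun z => h z + (starRingEnd ℂ) (g z)) '' ball 0 1)
    (hgω : ∀ z ∈ ball (0 : ℂ) 1, deriv g z = ω z * deriv h z) (hω0 : ω 0 = 0)
    {z : ℂ} (hz : z ∈ ball (0 : ℂ) 1) : ‖ω z‖ < 1 ∧ deriv h z ≠ 0 := by
  have hne : ∀ z ∈ ball (0 : ℂ) 1, ‖ω z‖ ≠ 1 := fun z hz h1 =>
    norm_deriv_ne_of_injOn hh hg hinj hcov hz (by rw [hgω z hz, norm_mul, h1, one_mul])
  refine ⟨?_, fun h0 => norm_deriv_ne_of_injOn hh hg hinj hcov hz (by simp [hgω z hz, h0])⟩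
  by_contra hlt
  obtain ⟨w, hw, hw1⟩ := (convex_ball (0 : ℂ) 1).isPreconnected.intermediate_value
    (mem_ball_self one_pos) hz hω.norm
    (show (1 : ℝ) ∈ Icc ‖ω 0‖ ‖ω z‖ from ⟨by simp [hω0], not_lt.1 hlt⟩)
  exact hne w hw hw1

/-- If `f` is an injective harmonic map of the disk covering the disk and `κ` is a harmonic map
into the closed disk with the same second Beltrami coefficient, then `f - t • κ` has no critical
point at the origin for `0 ≤ t < 1`. -/
theorem deriv_ne_mul_deriv_of_same_beltrami {h g k l ω : ℂ → ℂ} {t : ℝ}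
    (hh : DifferentiableOn ℂ h (ball 0 1)) (hg : DifferentiableOn ℂ g (ball 0 1))
    (hk : DifferentiableOn ℂ k (ball 0 1)) (hl : DifferentiableOn ℂ l (ball 0 1))
    (hgω : ∀ z ∈ ball (0 : ℂ) 1, deriv g z = ω z * deriv h z)
    (hlω : ∀ z ∈ ball (0 : ℂ) 1, deriv l z = ω z * deriv k z)
    (hω : ∀ z ∈ ball (0 : ℂ) 1, ‖ω z‖ < 1) (hh0 : ∀ z ∈ ball (0 : ℂ) 1, deriv h z ≠ 0)
    (hinj : InjOn (fun z => h z + (starRingEnd ℂ) (g z)) (ball 0 1))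
    (hcov : ball (0 : ℂ) 1 ⊆ (fun z => h z + (starRingEnd ℂ) (g z)) '' ball 0 1)
    (hκ : ∀ z ∈ ball (0 : ℂ) 1, ‖k z + (starRingEnd ℂ) (l z)‖ ≤ 1)
    (hf0 : h 0 + (starRingEnd ℂ) (g 0) = 0) (hκ0 : k 0 + (starRingEnd ℂ) (l 0) = 0)
    (ht : 0 ≤ t) (ht1 : t < 1) : deriv h 0 ≠ t * deriv k 0 := by
  intro hcrit
  have h0 : (0 : ℂ) ∈ ball (0 : ℂ) 1 := mem_ball_self one_pos
  set H : ℂ → ℂ := fun z => h z - t * k z with hH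
  set G : ℂ → ℂ := fun z => g z - t * l z with hG
  set F : ℂ → ℂ := fun z => H z + (starRingEnd ℂ) (G z) with hF
  have hFeq : ∀ z, h z + (starRingEnd ℂ) (g z) - t * (k z + (starRingEnd ℂ) (l z)) = F z := by
    intro z
    simp [hF, hH, hG]
    ring
  have hHd : DifferentiableOn ℂ H (ball 0 1) := hh.sub (hk.const_mul _)
  have hGd : DifferentiableOn ℂ G (ball 0 1) := hg.sub (hl.const_mul _)
  have hnhds : ∀ z ∈ ball (0 : ℂ) 1, ball (0 : ℂ) 1 ∈ nhds z := fun z hz => isOpen_ball.mem_nhds hz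
  have hH' : ∀ z ∈ ball (0 : ℂ) 1, deriv H z = deriv h z - t * deriv k z := fun z hz =>
    ((hh.differentiableAt (hnhds z hz)).hasDerivAt.sub
      ((hk.differentiableAt (hnhds z hz)).hasDerivAt.const_mul _)).deriv
  have hG' : ∀ z ∈ ball (0 : ℂ) 1, deriv G z = ω z * deriv H z := fun z hz => by
    refine ((hg.differentiableAt (hnhds z hz)).hasDerivAt.sub
      ((hl.differentiableAt (hnhds z hz)).hasDerivAt.const_mul _)).deriv.trans ?_
    rw [hH' z hz, hgω z hz, hlω z hz]
    ring
  have hH0 : deriv H 0 = 0 := by rw [hH' 0 h0, hcrit, sub_self]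
  have hG0 : deriv G 0 = 0 := by rw [hG' 0 h0, hH0, mul_zero]
  have hF0 : F 0 = 0 := by rw [← hFeq, hf0, hκ0]; simp
  have hFc : ∀ z ∈ ball (0 : ℂ) 1, ContinuousAt F z := fun z hz =>
    ((hHd.differentiableAt (hnhds z hz)).continuousAt).add
      (continuous_conj.continuousAt.comp (hGd.differentiableAt (hnhds z hz)).continuousAt)
  have hnc : ¬ ∀ᶠ z in nhds (0 : ℂ), deriv H z = 0 := by
    intro hev
    have hz : EqOn (deriv H) (fun _ => 0) (ball 0 1) :=
      ((hHd.analyticOnNhd isOpen_ball).deriv).eqOn_of_preconnected_of_eventuallyEq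
        analyticOnNhd_const (convex_ball _ _).isPreconnected h0 hev
    have hconst : ∀ {P : ℂ → ℂ}, DifferentiableOn ℂ P (ball 0 1) →
        (∀ z ∈ ball (0 : ℂ) 1, deriv P z = 0) → ∀ z ∈ ball (0 : ℂ) 1, P z = P 0 :=
      fun hP hP' z hz => isOpen_ball.is_const_of_deriv_eq_zero
        (convex_ball _ _).isPreconnected hP (fun z hz => hP' z hz) hz h0
    have hFz : ∀ z ∈ ball (0 : ℂ) 1, F z = 0 := fun z hz' => by
      rw [← hF0, hF]
      simp only
      rw [hconst hHd (fun z hz' => hz hz') z hz',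
        hconst hGd (fun z hz' => by rw [hG' z hz', hz hz', mul_zero]) z hz']
    obtain ⟨z, hz1, hz2⟩ := hcov (show (((1 + t) / 2 : ℝ) : ℂ) ∈ ball (0 : ℂ) 1 by
      rw [mem_ball_zero_iff, Complex.norm_real, Real.norm_of_nonneg (by linarith)]; linarith)
    have h1 := hFz z hz1
    rw [← hFeq, sub_eq_zero] at h1
    have h2 : ‖(t : ℂ) * (k z + (starRingEnd ℂ) (l z))‖ = (1 + t) / 2 := by
      rw [← h1]
      simp only at hz2
      rw [hz2, Complex.norm_real, Real.norm_of_nonneg (by linarith)]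
    rw [norm_mul, Complex.norm_real, Real.norm_of_nonneg ht] at h2
    nlinarith [hκ z hz1]
  have hmapF : ∀ z ∈ ball (0 : ℂ) 1, deriv H z ≠ 0 → Filter.map F (nhds z) = nhds (F z) := by
    intro z hz hne
    refine (hasStrictFDerivAt_add_conj (hHd.analyticAt (hnhds z hz)).hasStrictDerivAt
      (hGd.analyticAt (hnhds z hz)).hasStrictDerivAt).map_nhds_eq_of_injective
        (harmonicFDeriv_injective ?_)
    rw [hG' z hz, norm_mul]
    exact mul_lt_of_lt_one_left (norm_pos_iff.2 hne) (hω z hz)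
  have hsmall : ∀ᶠ z in nhds (0 : ℂ), z ∈ ball (0 : ℂ) 1 ∧ ‖F z‖ < 1 - t ∧
      (z ≠ 0 → deriv H z ≠ 0) := by
    refine Filter.Eventually.and (hnhds 0 h0) (Filter.Eventually.and ?_ ?_)
    · have := (hFc 0 h0).norm
      refine this.eventually_lt_const ?_
      show ‖F 0‖ < 1 - t
      rw [hF0, norm_zero]
      linarith
    · have := ((hHd.analyticAt (hnhds 0 h0)).deriv.eventually_eq_zero_or_eventually_ne_zero)
      exact eventually_nhdsWithin_iff.1 (this.resolve_left hnc)
  obtain ⟨r, hr, hrb⟩ := Metric.eventually_nhds_iff_ball.1 hsmall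
  have hninj : ¬ InjOn F (ball 0 r) := by
    refine not_injOn_of_re_eq_of_deriv_eq_zero (φ := fun z => H z + G z)
      (ball_mem_nhds 0 hr) (fun z hz => (hFc z (hrb z hz).1).continuousWithinAt)
      ((hHd.analyticAt (hnhds 0 h0)).add (hGd.analyticAt (hnhds 0 h0))) ?_ ?_ ?_
    · rw [deriv_fun_add (hHd.differentiableAt (hnhds 0 h0)) (hGd.differentiableAt (hnhds 0 h0)),
        hH0, hG0, add_zero]
    · intro hev
      apply hnc
      filter_upwards [hev.eventually_nhds, hnhds 0 h0] with z hz hzb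
      have h1 : deriv (fun z => H z + G z) z = 0 := by
        rw [Filter.EventuallyEq.deriv_eq hz, deriv_const]
      rw [deriv_fun_add (hHd.differentiableAt (hnhds z hzb)) (hGd.differentiableAt (hnhds z hzb)),
        hG' z hzb] at h1
      have h2 : (1 + ω z) * deriv H z = 0 := by linear_combination h1
      refine (mul_eq_zero.1 h2).resolve_left fun h3 => ?_
      have h4 : ω z = -1 := by linear_combination h3
      have := hω z hzb
      rw [h4] at this
      simp at this
    · intro z _
      simp [hF]
  obtain ⟨z, hz, z', hz', hne, hz0, hz0', hFz⟩ : ∃ z ∈ ball (0 : ℂ) r, ∃ z' ∈ ball (0 : ℂ) r,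
      z ≠ z' ∧ z ≠ 0 ∧ z' ≠ 0 ∧ F z = F z' := by
    have hcase : ∀ w ∈ ball (0 : ℂ) r, w ≠ 0 → F w = F 0 → ∃ z ∈ ball (0 : ℂ) r,
        ∃ z' ∈ ball (0 : ℂ) r, z ≠ z' ∧ z ≠ 0 ∧ z' ≠ 0 ∧ F z = F z' := by
      intro w hw hw0 hFw
      obtain ⟨V, V', hV, hV', hd⟩ := t2_separation_nhds hw0
      have h1 : F '' (V ∩ (ball 0 r ∩ {0}ᶜ)) ∈ nhds (F 0) := by
        rw [← hFw, ← hmapF w (hrb w hw).1 ((hrb w hw).2.2 hw0)]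
        exact Filter.image_mem_map (Filter.inter_mem hV
          (Filter.inter_mem (isOpen_ball.mem_nhds hw) (isOpen_ne.mem_nhds hw0)))
      have h2 : F ⁻¹' (F '' (V ∩ (ball 0 r ∩ {0}ᶜ))) ∩ (V' ∩ ball 0 r) ∈ nhds (0 : ℂ) :=
        Filter.inter_mem ((hFc 0 h0).preimage_mem_nhds h1)
          (Filter.inter_mem hV' (ball_mem_nhds 0 hr))
      have h3 : ∀ᶠ z in nhdsWithin (0 : ℂ) {0}ᶜ,
          z ∈ F ⁻¹' (F '' (V ∩ (ball 0 r ∩ {0}ᶜ))) ∩ (V' ∩ ball 0 r) :=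
        nhdsWithin_le_nhds h2
      obtain ⟨y, ⟨⟨x, hx, hxy⟩, hyV, hyr⟩, hy0⟩ := (h3.and self_mem_nhdsWithin).exists
      exact ⟨x, hx.2.1, y, hyr, fun he => disjoint_left.1 hd hx.1 (he ▸ hyV), hx.2.2, hy0, hxy⟩
    simp only [InjOn, not_forall] at hninj
    obtain ⟨a, ha, b, hb, hab, hne⟩ := hninj
    by_cases ha0 : a = 0
    · subst ha0
      exact hcase b hb (Ne.symm hne) hab.symm
    · by_cases hb0 : b = 0
      · subst hb0
        exact hcase a ha hne hab
      · exact ⟨a, ha, b, hb, hne, ha0, hb0, hab⟩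
  obtain ⟨V, V', hV, hV', hd⟩ := t2_separation_nhds hne
  have hN : F '' (V ∩ ball 0 r) ∩ F '' (V' ∩ ball 0 r) ∈ nhds (F z) := by
    refine Filter.inter_mem ?_ ?_
    · rw [← hmapF z (hrb z hz).1 ((hrb z hz).2.2 hz0)]
      exact Filter.image_mem_map (Filter.inter_mem hV (isOpen_ball.mem_nhds hz))
    · rw [hFz, ← hmapF z' (hrb z' hz').1 ((hrb z' hz').2.2 hz0')]
      exact Filter.image_mem_map (Filter.inter_mem hV' (isOpen_ball.mem_nhds hz'))
  have hnull := volume_critical_values_eq_zero isOpen_ball hh hg hk hl hgω hlω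
  have hpos : MeasureTheory.volume (F '' (V ∩ ball 0 r) ∩ F '' (V' ∩ ball 0 r)) ≠ 0 :=
    (MeasureTheory.Measure.measure_pos_of_mem_nhds _ hN).ne'
  obtain ⟨c, ⟨⟨x, hx, hxc⟩, y, hy, hyc⟩, hcreg⟩ := not_subset.1
    fun hsub => hpos (MeasureTheory.measure_mono_null hsub hnull)
  have hxy : x = y := by
    refine sub_mul_eq_unique_of_regular (c := c) hh hg hk hl hgω hlω hω hh0 hinj hcov hκ ht ?_ ?_
      x (hrb x hx.2).1 y (hrb y hy.2).1 ((hFeq x).trans hxc) ((hFeq y).trans hyc)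
    · have := (hrb x hx.2).2.1
      rw [hxc] at this
      linarith
    · intro s _ w hw hwc heq
      exact hcreg ⟨s, w, hw, hh0 w hw, heq, hwc⟩
  exact disjoint_left.1 hd hx.1 (hxy ▸ hy.1)

theorem one_sub_ne_zero_of_mem_ball {ζ : ℂ} (hζ : ζ ∈ ball (0 : ℂ) 1) : 1 - ζ ≠ 0 := by
  intro h
  rw [← sub_eq_zero.1 h] at hζ
  simp at hζ

theorem re_cayley_pos {ζ : ℂ} (hζ : ζ ∈ ball (0 : ℂ) 1) : 0 < ((1 + ζ) / (1 - ζ)).re := by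
  have h1 := one_sub_ne_zero_of_mem_ball hζ
  rw [mem_ball_zero_iff] at hζ
  have h2 : (1 + ζ) / (1 - ζ) = (1 + ζ) * (starRingEnd ℂ) (1 - ζ) / (normSq (1 - ζ) : ℝ) := by
    rw [← Complex.mul_conj]
    have : (starRingEnd ℂ) (1 - ζ) ≠ 0 := (map_ne_zero _).2 h1
    field_simp
  rw [h2, div_ofReal_re]
  refine div_pos ?_ (normSq_pos.2 h1)
  have h3 : normSq ζ < 1 := by
    rw [Complex.normSq_eq_norm_sq]
    nlinarith [norm_nonneg ζ]
  rw [normSq_apply] at h3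
  simp
  nlinarith

theorem hasDerivAt_log_cayley {ζ : ℂ} (hζ : ζ ∈ ball (0 : ℂ) 1) :
    HasDerivAt (fun ζ => log ((1 + ζ) / (1 - ζ))) (2 / (1 - ζ ^ 2)) ζ := by
  have h1 := one_sub_ne_zero_of_mem_ball hζ
  have h2 : 1 + ζ ≠ 0 := by
    have := one_sub_ne_zero_of_mem_ball (ζ := -ζ) (by simpa using hζ)
    simpa using this
  have h4 : 1 - ζ ^ 2 ≠ 0 := by
    rw [show 1 - ζ ^ 2 = (1 - ζ) * (1 + ζ) by ring]
    exact mul_ne_zero h1 h2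
  have h3 := (((hasDerivAt_id ζ).const_add 1).fun_div ((hasDerivAt_id ζ).const_sub 1) h1).clog
    (Or.inl (re_cayley_pos hζ))
  refine h3.congr_deriv ?_
  simp only [id]
  field_simp
  ring

theorem abs_im_log_cayley_le {ζ : ℂ} (hζ : ζ ∈ ball (0 : ℂ) 1) :
    |(log ((1 + ζ) / (1 - ζ))).im| ≤ Real.pi / 2 := by
  rw [log_im]
  exact (abs_arg_lt_pi_div_two_iff.2 (Or.inl (re_cayley_pos hζ))).le

/-- The harmonic map of the disk onto an inscribed square underlying Scherk's minimal surface. -/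
theorem exists_scherk_harmonic_map : ∃ H G : ℂ → ℂ,
    DifferentiableOn ℂ H (ball 0 1) ∧ DifferentiableOn ℂ G (ball 0 1) ∧
    (∀ z ∈ ball (0 : ℂ) 1, deriv G z = z ^ 2 * deriv H z) ∧
    (∀ z ∈ ball (0 : ℂ) 1, ‖H z + (starRingEnd ℂ) (G z)‖ ≤ 1) ∧
    H 0 = 0 ∧ G 0 = 0 ∧ deriv H 0 = (2 * Real.sqrt 2 / Real.pi : ℝ) := by
  obtain ⟨a, ha⟩ := IsAlgClosed.exists_pow_nat_eq I two_pos
  set b := (starRingEnd ℂ) a with hb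
  have han : ‖a‖ = 1 := by
    have := congrArg norm ha
    rw [norm_pow, norm_I] at this
    exact (pow_eq_one_iff_of_nonneg (norm_nonneg _) two_ne_zero).1 this
  have hbn : ‖b‖ = 1 := by rw [hb, RCLike.norm_conj, han]
  have hab : a * b = 1 := by
    rw [hb, Complex.mul_conj, Complex.normSq_eq_norm_sq, han]; simp
  have hb2 : b ^ 2 = -I := by rw [hb, ← map_pow, ha, conj_I]
  have hcb : (starRingEnd ℂ) b = a := by simp [hb]
  have hIa : I * b = a := by linear_combination -b * ha + a * hab
  set C : ℝ := 2 * Real.sqrt 2 / Real.pi with hC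
  set L : ℂ → ℂ := fun ζ => log ((1 + ζ) / (1 - ζ)) with hL
  have hmem : ∀ u : ℂ, ‖u‖ = 1 → ∀ z ∈ ball (0 : ℂ) 1, u * z ∈ ball (0 : ℂ) 1 := by
    intro u hu z hz
    simpa [hu] using hz
  have hLd : ∀ u : ℂ, ‖u‖ = 1 → ∀ z ∈ ball (0 : ℂ) 1,
      HasDerivAt (fun z => L (u * z)) (2 / (1 - (u * z) ^ 2) * u) z := by
    intro u hu z hz
    have h1 := (hasDerivAt_id z).const_mul u
    rw [mul_one] at h1
    exact (hasDerivAt_log_cayley (hmem u hu z hz)).comp z h1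
  have hne : ∀ z ∈ ball (0 : ℂ) 1, 1 - I * z ^ 2 ≠ 0 ∧ 1 + I * z ^ 2 ≠ 0 := by
    intro z hz
    have hz2 : z ^ 2 ∈ ball (0 : ℂ) 1 := by
      rw [mem_ball_zero_iff] at hz ⊢
      rw [norm_pow]
      exact pow_lt_one₀ (norm_nonneg _) hz two_ne_zero
    refine ⟨one_sub_ne_zero_of_mem_ball (hmem I (by simp) _ hz2), ?_⟩
    have := one_sub_ne_zero_of_mem_ball (hmem (-I) (by simp) _ hz2)
    rwa [neg_mul, sub_neg_eq_add] at this
  have hHd : ∀ z ∈ ball (0 : ℂ) 1, HasDerivAt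
      (fun z => (C / 4 : ℂ) * (b * L (a * z) + a * L (b * z)))
      (C / (1 + z ^ 4)) z := by
    intro z hz
    refine ((((hLd a han z hz).const_mul b).fun_add
      ((hLd b hbn z hz).const_mul a)).const_mul (C / 4 : ℂ)).congr_deriv ?_
    obtain ⟨h1, h2⟩ := hne z hz
    have h4 : 1 + z ^ 4 = (1 - I * z ^ 2) * (1 + I * z ^ 2) := by
      linear_combination z ^ 4 * I_sq
    rw [mul_pow, mul_pow, ha, hb2, h4]
    rw [show b * (2 / (1 - I * z ^ 2) * a) = (a * b) * (2 / (1 - I * z ^ 2)) by ring,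
      show a * (2 / (1 - -I * z ^ 2) * b) = (a * b) * (2 / (1 + I * z ^ 2)) by ring, hab]
    field_simp
    ring
  have hGd : ∀ z ∈ ball (0 : ℂ) 1, HasDerivAt
      (fun z => (-I * C / 4 : ℂ) * (b * L (a * z) - a * L (b * z)))
      (z ^ 2 * (C / (1 + z ^ 4))) z := by
    intro z hz
    refine ((((hLd a han z hz).const_mul b).fun_sub
      ((hLd b hbn z hz).const_mul a)).const_mul (-I * C / 4 : ℂ)).congr_deriv ?_
    obtain ⟨h1, h2⟩ := hne z hz
    have h4 : 1 + z ^ 4 = (1 - I * z ^ 2) * (1 + I * z ^ 2) := by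
      linear_combination z ^ 4 * I_sq
    rw [mul_pow, mul_pow, ha, hb2, h4]
    rw [show b * (2 / (1 - I * z ^ 2) * a) = (a * b) * (2 / (1 - I * z ^ 2)) by ring,
      show a * (2 / (1 - -I * z ^ 2) * b) = (a * b) * (2 / (1 + I * z ^ 2)) by ring, hab]
    field_simp
    linear_combination (-4 * C * z ^ 2) * I_sq
  refine ⟨_, _, fun z hz => (hHd z hz).differentiableAt.differentiableWithinAt,
    fun z hz => (hGd z hz).differentiableAt.differentiableWithinAt, fun z hz => ?_, fun z hz => ?_,
    by simp [hL], by simp [hL], ?_⟩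
  · rw [(hHd z hz).deriv, (hGd z hz).deriv]
  · set A := L (a * z) with hA
    set B := L (b * z) with hB
    have hAi : |A.im| ≤ Real.pi / 2 := abs_im_log_cayley_le (hmem a han z hz)
    have hBi : |B.im| ≤ Real.pi / 2 := abs_im_log_cayley_le (hmem b hbn z hz)
    have hAA : A - (starRingEnd ℂ) A = 2 * I * A.im := by rw [sub_conj]; push_cast; ring
    have hBB : B - (starRingEnd ℂ) B = 2 * I * B.im := by rw [sub_conj]; push_cast; ring
    have hval : (C / 4 : ℂ) * (b * A + a * B) +
        (starRingEnd ℂ) ((-I * C / 4 : ℂ) * (b * A - a * B)) =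
        (C / 2 : ℝ) * (a * (A.im + I * B.im)) := by
      have hIa' : I * a = -b := by linear_combination (-I) * hIa + b * I_sq
      simp only [map_mul, map_sub, map_div₀, map_neg, conj_I, conj_ofReal, map_ofNat, hcb, ← hb]
      push_cast
      linear_combination (C / 4 : ℂ) * (b * hAA + a * hBB) +
        (C / 4 : ℂ) * ((starRingEnd ℂ) A * hIa' - (starRingEnd ℂ) B * hIa) +
        (C / 2 : ℂ) * A.im * hIa
    rw [hval, norm_mul, norm_mul, han, one_mul, Complex.norm_real,
      Real.norm_of_nonneg (by positivity)]
    have hsq : ‖(A.im : ℂ) + I * B.im‖ ^ 2 = A.im ^ 2 + B.im ^ 2 := by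
      rw [← Complex.normSq_eq_norm_sq, normSq_apply]; simp; ring
    have hle : ‖(A.im : ℂ) + I * B.im‖ ≤ Real.pi / Real.sqrt 2 := by
      refine le_of_sq_le_sq ?_ (by positivity)
      rw [hsq, div_pow, Real.sq_sqrt two_pos.le]
      have h1 := sq_le_sq' (abs_le.1 hAi).1 (abs_le.1 hAi).2
      have h2 := sq_le_sq' (abs_le.1 hBi).1 (abs_le.1 hBi).2
      nlinarith
    calc C / 2 * ‖(A.im : ℂ) + I * B.im‖ ≤ C / 2 * (Real.pi / Real.sqrt 2) := by gcongr
      _ = 1 := by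
        have := Real.pi_ne_zero
        rw [hC]; field_simp
  · rw [(hHd 0 (mem_ball_self one_pos)).deriv]; simp

/-- The Finn–Osserman inequality in terms of the harmonic parametrization. -/
theorem norm_deriv_ge_of_injOn_of_beltrami_sq {h g q : ℂ → ℂ}
    (hh : DifferentiableOn ℂ h (ball 0 1)) (hg : DifferentiableOn ℂ g (ball 0 1))
    (hq : DifferentiableOn ℂ q (ball 0 1))
    (hinj : InjOn (fun z => h z + (starRingEnd ℂ) (g z)) (ball 0 1))
    (hcov : ball (0 : ℂ) 1 ⊆ (fun z => h z + (starRingEnd ℂ) (g z)) '' ball 0 1)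
    (hbel : ∀ z ∈ ball (0 : ℂ) 1, deriv g z = q z ^ 2 * deriv h z)
    (hf0 : h 0 + (starRingEnd ℂ) (g 0) = 0) (hq0 : q 0 = 0) :
    2 * Real.sqrt 2 / Real.pi * ‖deriv q 0‖ ≤ ‖deriv h 0‖ := by
  have h0 : (0 : ℂ) ∈ ball (0 : ℂ) 1 := mem_ball_self one_pos
  have hlt := fun z (hz : z ∈ ball (0 : ℂ) 1) => norm_beltrami_lt_one_and_deriv_ne_zero
    (ω := fun z => q z ^ 2) hh hg (hq.continuousOn.pow 2) hinj hcov hbel (by simp [hq0]) hz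
  have hq1 : ∀ z ∈ ball (0 : ℂ) 1, ‖q z‖ < 1 := fun z hz => by
    have := (hlt z hz).1
    rw [norm_pow] at this
    exact (pow_lt_one_iff_of_nonneg (norm_nonneg _) two_ne_zero).1 this
  obtain ⟨H, G, hH, hG, hGH, hHG, hH0, hG0, hHd⟩ := exists_scherk_harmonic_map
  set C : ℝ := 2 * Real.sqrt 2 / Real.pi with hC
  have hCpos : 0 < C := by positivity
  by_contra hcon
  push Not at hcon
  have hh0 : deriv h 0 ≠ 0 := (hlt 0 h0).2
  have hqpos : 0 < ‖deriv q 0‖ := by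
    by_contra hle
    have : ‖deriv q 0‖ = 0 := le_antisymm (not_lt.1 hle) (norm_nonneg _)
    rw [this, mul_zero] at hcon
    exact hcon.not_ge (norm_nonneg _)
  have hq' : deriv q 0 ≠ 0 := norm_pos_iff.1 hqpos
  set t : ℝ := ‖deriv h 0‖ / (C * ‖deriv q 0‖) with ht
  have hCq : 0 < C * ‖deriv q 0‖ := by positivity
  have ht0 : 0 < t := div_pos (norm_pos_iff.2 hh0) hCq
  have ht1 : t < 1 := (div_lt_one hCq).2 hcon
  obtain ⟨α, hα⟩ := IsAlgClosed.exists_pow_nat_eq (deriv h 0 / (t * C * deriv q 0)) two_pos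
  have hαn : ‖α‖ = 1 := by
    have := congrArg norm hα
    rw [norm_pow, norm_div, norm_mul, norm_mul, Complex.norm_real, Complex.norm_real,
      Real.norm_of_nonneg ht0.le, Real.norm_of_nonneg hCpos.le, mul_assoc, ht,
      div_mul_cancel₀ _ hCq.ne', div_self (norm_ne_zero_iff.2 hh0)] at this
    exact (pow_eq_one_iff_of_nonneg (norm_nonneg _) two_ne_zero).1 this
  have hα1 : (starRingEnd ℂ) α * α = 1 := by
    rw [mul_comm, Complex.mul_conj, Complex.normSq_eq_norm_sq, hαn]; simp
  have hmem : ∀ z ∈ ball (0 : ℂ) 1, α * q z ∈ ball (0 : ℂ) 1 := fun z hz => by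
    rw [mem_ball_zero_iff, norm_mul, hαn, one_mul]
    exact hq1 z hz
  have hcomp : ∀ P : ℂ → ℂ, DifferentiableOn ℂ P (ball 0 1) → ∀ β : ℂ, ∀ z ∈ ball (0 : ℂ) 1,
      HasDerivAt (fun z => β * P (α * q z)) (β * (deriv P (α * q z) * (α * deriv q z))) z := by
    intro P hP β z hz
    have h1 := (hP.differentiableAt (isOpen_ball.mem_nhds (hmem z hz))).hasDerivAt
    have h2 := (hq.differentiableAt (isOpen_ball.mem_nhds hz)).hasDerivAt.const_mul α
    exact (h1.comp z h2).const_mul β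
  refine deriv_ne_mul_deriv_of_same_beltrami (ω := fun z => q z ^ 2) (t := t)
    (k := fun z => α * H (α * q z)) (l := fun z => (starRingEnd ℂ) α * G (α * q z)) hh hg
    (fun z hz => (hcomp H hH _ z hz).differentiableAt.differentiableWithinAt)
    (fun z hz => (hcomp G hG _ z hz).differentiableAt.differentiableWithinAt)
    hbel ?_ (fun z hz => (hlt z hz).1) (fun z hz => (hlt z hz).2) hinj hcov ?_ hf0 ?_ ht0.le ht1 ?_
  · intro z hz
    rw [(hcomp H hH _ z hz).deriv, (hcomp G hG _ z hz).deriv, hGH _ (hmem z hz)]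
    linear_combination (α ^ 2 * q z ^ 2 * deriv H (α * q z) * deriv q z) * hα1
  · intro z hz
    have : α * H (α * q z) + (starRingEnd ℂ) ((starRingEnd ℂ) α * G (α * q z)) =
        α * (H (α * q z) + (starRingEnd ℂ) (G (α * q z))) := by
      simp [mul_add]
    rw [this, norm_mul, hαn, one_mul]
    exact hHG _ (hmem z hz)
  · simp [hq0, hH0, hG0]
  · rw [(hcomp H hH _ 0 h0).deriv, hq0, mul_zero, hHd]
    have htC : (t : ℂ) ≠ 0 := by exact_mod_cast ht0.ne'
    have hCC : (C : ℂ) ≠ 0 := by exact_mod_cast hCpos.ne'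
    have hα' : deriv h 0 = α ^ 2 * (t * C * deriv q 0) := by
      rw [hα]; field_simp
    rw [hα']
    ring

/-- A bound on a harmonic map `P + conj ∘ Q` controls `P` and `Q` up to constants. -/
theorem norm_sub_le_of_norm_add_conj_le {P Q : ℂ → ℂ} {ε : ℝ} (hε : 0 < ε)
    (hP : DifferentiableOn ℂ P (ball 0 1)) (hQ : DifferentiableOn ℂ Q (ball 0 1))
    (hPQ : ∀ z ∈ ball (0 : ℂ) (1 / 2), ‖P z + (starRingEnd ℂ) (Q z)‖ ≤ ε)
    {z : ℂ} (hz : z ∈ ball (0 : ℂ) (1 / 4)) :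
    ‖P z - P 0‖ ≤ 4 * ε ∧ ‖Q z - Q 0‖ ≤ 4 * ε := by
  have hsub : ball (0 : ℂ) (1 / 2) ⊆ ball 0 1 := ball_subset_ball (by norm_num)
  have hz2 : z ∈ ball (0 : ℂ) (1 / 2) := ball_subset_ball (by norm_num) hz
  have h0 : (0 : ℂ) ∈ ball (0 : ℂ) (1 / 2) := mem_ball_self (by norm_num)
  have hzn : ‖z‖ < 1 / 4 := mem_ball_zero_iff.1 hz
  have key : ∀ S : ℂ → ℂ, DifferentiableOn ℂ S (ball 0 1) →
      (∀ z ∈ ball (0 : ℂ) (1 / 2), |(S z).re| ≤ ε) → ‖S z - S 0‖ ≤ 4 * ε := by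
    intro S hS hre
    have := borelCaratheodory_zero (M := 2 * ε) (f := fun z => S z - S 0) (R := 1 / 2) (z := z)
      (by positivity) ((hS.mono hsub).sub_const _)
      (fun w hw => by
        have h1 := abs_le.1 (hre w hw)
        have h2 := abs_le.1 (hre 0 h0)
        show (S w - S 0).re ≤ 2 * ε
        rw [sub_re]
        linarith) (by norm_num) hz2 (by simp)
    refine this.trans ?_
    rw [div_le_iff₀ (by linarith)]
    nlinarith
  have h1 := key (fun z => P z + Q z) (hP.add hQ) fun z hz => by
    have := (abs_re_le_norm _).trans (hPQ z hz)
    simpa using this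
  have h2 := key (fun z => -I * (P z - Q z)) ((hP.sub hQ).const_mul _) fun z hz => by
    have := (abs_im_le_norm _).trans (hPQ z hz)
    simpa [sub_eq_add_neg] using this
  have h2' : ‖(P z - P 0) - (Q z - Q 0)‖ ≤ 4 * ε := by
    have e : -I * (P z - Q z) - -I * (P 0 - Q 0) = -I * ((P z - P 0) - (Q z - Q 0)) := by ring
    simp only [e, norm_mul, norm_neg, norm_I, one_mul] at h2
    exact h2
  have h1' : ‖(P z - P 0) + (Q z - Q 0)‖ ≤ 4 * ε := by
    rwa [show (P z - P 0) + (Q z - Q 0) = P z + Q z - (P 0 + Q 0) by ring]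
  constructor
  · have e : (2 : ℂ) * (P z - P 0) =
        ((P z - P 0) + (Q z - Q 0)) + ((P z - P 0) - (Q z - Q 0)) := by ring
    have h3 := norm_add_le ((P z - P 0) + (Q z - Q 0)) ((P z - P 0) - (Q z - Q 0))
    rw [← e, norm_mul, Complex.norm_ofNat] at h3
    linarith
  · have e : (2 : ℂ) * (Q z - Q 0) =
        ((P z - P 0) + (Q z - Q 0)) - ((P z - P 0) - (Q z - Q 0)) := by ring
    have h3 := norm_sub_le ((P z - P 0) + (Q z - Q 0)) ((P z - P 0) - (Q z - Q 0))
    rw [← e, norm_mul, Complex.norm_ofNat] at h3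
    linarith

/-- Locally uniform convergence of harmonic maps entails that of the derivatives of their
holomorphic and antiholomorphic parts. -/
theorem tendstoLocallyUniformlyOn_deriv_of_add_conj {h g : ℂ → ℂ} {hn gn : ℕ → ℂ → ℂ}
    (hh : DifferentiableOn ℂ h (ball 0 1)) (hg : DifferentiableOn ℂ g (ball 0 1))
    (hhn : ∀ n, DifferentiableOn ℂ (hn n) (ball 0 1))
    (hgn : ∀ n, DifferentiableOn ℂ (gn n) (ball 0 1))
    (hconv : TendstoLocallyUniformlyOn (fun n z => hn n z + (starRingEnd ℂ) (gn n z))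
      (fun z => h z + (starRingEnd ℂ) (g z)) Filter.atTop (ball 0 1)) :
    TendstoLocallyUniformlyOn (fun n => deriv (hn n)) (deriv h) Filter.atTop (ball 0 (1 / 4)) ∧
    TendstoLocallyUniformlyOn (fun n => deriv (gn n)) (deriv g) Filter.atTop
      (ball 0 (1 / 4)) := by
  have hsub : ball (0 : ℂ) (1 / 4) ⊆ ball 0 1 := ball_subset_ball (by norm_num)
  have hU := (tendstoLocallyUniformlyOn_iff_forall_isCompact isOpen_ball).1 hconv
    (closedBall 0 (1 / 2)) (closedBall_subset_ball (by norm_num)) (isCompact_closedBall _ _)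
  rw [Metric.tendstoUniformlyOn_iff] at hU
  have key : ∀ ε > 0, ∀ᶠ n in Filter.atTop, ∀ z ∈ ball (0 : ℂ) (1 / 4),
      ‖(h z - hn n z) - (h 0 - hn n 0)‖ < ε ∧ ‖(g z - gn n z) - (g 0 - gn n 0)‖ < ε := by
    intro ε hε
    filter_upwards [hU (ε / 8) (by positivity)] with n hn' z hz
    have := norm_sub_le_of_norm_add_conj_le (P := fun z => h z - hn n z)
      (Q := fun z => g z - gn n z) (ε := ε / 8) (by positivity) (hh.sub (hhn n)) (hg.sub (hgn n))
      (fun w hw => by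
        have h1 := (hn' w (ball_subset_closedBall hw)).le
        rw [dist_eq_norm] at h1
        refine le_trans (le_of_eq ?_) h1
        rw [map_sub]
        congr 1
        ring) hz
    constructor <;> linarith [this.1, this.2]
  have hderiv : ∀ {p : ℂ → ℂ} {pn : ℕ → ℂ → ℂ},
      (∀ n, DifferentiableOn ℂ (pn n) (ball 0 1)) →
      (∀ ε > 0, ∀ᶠ n in Filter.atTop, ∀ z ∈ ball (0 : ℂ) (1 / 4),
        ‖(p z - pn n z) - (p 0 - pn n 0)‖ < ε) →
      TendstoLocallyUniformlyOn (fun n => deriv (pn n)) (deriv p) Filter.atTop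
        (ball 0 (1 / 4)) := by
    intro p pn hpn hp
    have h1 : TendstoUniformlyOn (fun n z => pn n z - pn n 0) (fun z => p z - p 0) Filter.atTop
        (ball 0 (1 / 4)) := by
      rw [Metric.tendstoUniformlyOn_iff]
      intro ε hε
      filter_upwards [hp ε hε] with n hn' z hz
      rw [dist_eq_norm, show p z - p 0 - (pn n z - pn n 0) = (p z - pn n z) - (p 0 - pn n 0) by
        ring]
      exact hn' z hz
    have h2 := h1.tendstoLocallyUniformlyOn.deriv
      (Filter.Eventually.of_forall fun n => ((hpn n).mono hsub).sub_const _) isOpen_ball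
    refine (h2.congr fun n z _ => ?_).congr_right fun z _ => ?_
    · simp
    · simp
  exact ⟨hderiv hhn fun ε hε => (key ε hε).mono fun n hn' z hz => (hn' z hz).1,
    hderiv hgn fun ε hε => (key ε hε).mono fun n hn' z hz => (hn' z hz).2⟩

theorem deriv_deriv_deriv_eq_of_beltrami_sq {h g q : ℂ → ℂ}
    (hh : DifferentiableOn ℂ h (ball 0 1)) (hq : DifferentiableOn ℂ q (ball 0 1))
    (hbel : ∀ z ∈ ball (0 : ℂ) 1, deriv g z = q z ^ 2 * deriv h z) (hq0 : q 0 = 0) :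
    deriv (deriv (deriv g)) 0 = 2 * deriv q 0 ^ 2 * deriv h 0 := by
  have hnhds : ∀ z ∈ ball (0 : ℂ) 1, ball (0 : ℂ) 1 ∈ nhds z := fun z hz => isOpen_ball.mem_nhds hz
  have h0 : (0 : ℂ) ∈ ball (0 : ℂ) 1 := mem_ball_self one_pos
  have h2 : ∀ z ∈ ball (0 : ℂ) 1, deriv (deriv g) z =
      q z * (2 * deriv q z * deriv h z + q z * deriv (deriv h) z) := by
    intro z hz
    have hev : deriv g =ᶠ[nhds z] fun z => q z ^ 2 * deriv h z :=
      Filter.eventually_of_mem (hnhds z hz) hbel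
    have hd := ((hq.differentiableAt (hnhds z hz)).hasDerivAt.fun_pow 2).fun_mul
      (hh.analyticAt (hnhds z hz)).deriv.differentiableAt.hasDerivAt
    rw [hev.deriv_eq, hd.deriv]
    push_cast
    ring
  have hev : deriv (deriv g) =ᶠ[nhds 0] fun z =>
      q z * (2 * deriv q z * deriv h z + q z * deriv (deriv h) z) :=
    Filter.eventually_of_mem (hnhds 0 h0) h2
  have hqa := hq.analyticAt (hnhds 0 h0)
  have hha := hh.analyticAt (hnhds 0 h0)
  have hR : DifferentiableAt ℂ
      (fun z => 2 * deriv q z * deriv h z + q z * deriv (deriv h) z) 0 :=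
    ((hqa.deriv.differentiableAt.const_mul 2).fun_mul hha.deriv.differentiableAt).fun_add
      (hqa.differentiableAt.fun_mul hha.deriv.deriv.differentiableAt)
  rw [hev.deriv_eq, (hqa.differentiableAt.hasDerivAt.fun_mul hR.hasDerivAt).deriv, hq0]
  ring

/-- **Sharp lower bound for `h'(0)`.**  Suppose `f = h + conj ∘ g` is a harmonic map
on the unit disk with `f(0) = 0`, `h'(0) > 0` real, second Beltrami coefficient `z²`
(i.e. `g' = z² h'`), and `f` is a locally uniform limit on the disk of harmonic
diffeomorphisms `fₙ = hₙ + conj ∘ gₙ` onto domains containing the disk, whose second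
Beltrami coefficients are squares `qₙ²` of holomorphic functions, with `fₙ(0) = 0` and
`gₙ'(0) = 0`.  Then `h'(0) ≥ 2√2/π`. -/
theorem deriv_lower_bound_of_limit_of_harmonic_diffeos
    (h g : ℂ → ℂ)
    (hh : DifferentiableOn ℂ h (ball 0 1))
    (hg : DifferentiableOn ℂ g (ball 0 1))
    (f : ℂ → ℂ) (hfdef : f = fun z => h z + (starRingEnd ℂ) (g z))
    (hf0 : f 0 = 0)
    (hpos : ∃ c : ℝ, 0 < c ∧ deriv h 0 = (c : ℂ))
    (hbel : ∀ z ∈ ball (0 : ℂ) 1, deriv g z = z ^ 2 * deriv h z)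
    (hn gn qn : ℕ → ℂ → ℂ)
    (hhn : ∀ n, DifferentiableOn ℂ (hn n) (ball 0 1))
    (hgn : ∀ n, DifferentiableOn ℂ (gn n) (ball 0 1))
    (hqn : ∀ n, DifferentiableOn ℂ (qn n) (ball 0 1))
    (fn : ℕ → ℂ → ℂ) (hfndef : ∀ n, fn n = fun z => hn n z + (starRingEnd ℂ) (gn n z))
    (hinj : ∀ n, Set.InjOn (fn n) (ball 0 1))
    (hcov : ∀ n, ball (0 : ℂ) 1 ⊆ fn n '' ball 0 1)
    (hbeln : ∀ n, ∀ z ∈ ball (0 : ℂ) 1, deriv (gn n) z = qn n z ^ 2 * deriv (hn n) z)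
    (hfn0 : ∀ n, fn n 0 = 0)
    (hgn0 : ∀ n, deriv (gn n) 0 = 0)
    (hconv : TendstoLocallyUniformlyOn fn f Filter.atTop (ball 0 1)) :
    2 * Real.sqrt 2 / Real.pi ≤ (deriv h 0).re := by
  obtain ⟨c, hc, hhc⟩ := hpos
  have h0 : (0 : ℂ) ∈ ball (0 : ℂ) 1 := mem_ball_self one_pos
  have h0' : (0 : ℂ) ∈ ball (0 : ℂ) (1 / 4) := mem_ball_self (by norm_num)
  have hfn : fn = fun n z => hn n z + (starRingEnd ℂ) (gn n z) := funext hfndef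
  subst hfn hfdef
  obtain ⟨hhlim, hglim⟩ := tendstoLocallyUniformlyOn_deriv_of_add_conj hh hg hhn hgn hconv
  have hsub : ball (0 : ℂ) (1 / 4) ⊆ ball 0 1 := ball_subset_ball (by norm_num)
  have hh0 := hhlim.tendsto_at h0'
  have hd1 : ∀ n, DifferentiableOn ℂ (deriv (gn n)) (ball 0 (1 / 4)) :=
    fun n => ((hgn n).deriv isOpen_ball).mono hsub
  have hg2 := hglim.deriv (Filter.Eventually.of_forall hd1) isOpen_ball
  have hg3 := (hg2.deriv (Filter.Eventually.of_forall fun n => (hd1 n).deriv isOpen_ball)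
    isOpen_ball).tendsto_at h0'
  simp only [Function.comp_apply] at hg3
  rw [deriv_deriv_deriv_eq_of_beltrami_sq hh differentiableOn_id hbel rfl] at hg3
  have hne : ∀ᶠ n in Filter.atTop, deriv (hn n) 0 ≠ 0 :=
    hh0.eventually_ne (by rw [hhc]; exact_mod_cast hc.ne')
  have hle : ∀ᶠ n in Filter.atTop, (2 * Real.sqrt 2 / Real.pi) ^ 2 *
      ‖deriv (deriv (deriv (gn n))) 0‖ ≤ 2 * ‖deriv (hn n) 0‖ ^ 3 := by
    filter_upwards [hne] with n hn0
    have hq0 : qn n 0 = 0 := by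
      have h1 := hbeln n 0 h0
      rw [hgn0 n] at h1
      exact pow_eq_zero_iff two_ne_zero |>.1 ((mul_eq_zero.1 h1.symm).resolve_right hn0)
    have h1 := norm_deriv_ge_of_injOn_of_beltrami_sq (hhn n) (hgn n) (hqn n) (hinj n) (hcov n)
      (hbeln n) (hfn0 n) hq0
    rw [deriv_deriv_deriv_eq_of_beltrami_sq (hhn n) (hqn n) (hbeln n) hq0, norm_mul, norm_mul,
      norm_pow, Complex.norm_ofNat]
    have h2 := pow_le_pow_left₀ (by positivity) h1 2
    have h3 := mul_le_mul_of_nonneg_right h2 (norm_nonneg (deriv (hn n) 0))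
    rw [mul_pow] at h3
    nlinarith
  have hlim := le_of_tendsto_of_tendsto (hg3.norm.const_mul _) ((hh0.norm.pow 3).const_mul 2) hle
  simp only [deriv_id, hhc, norm_mul, one_pow, Complex.norm_ofNat, mul_one,
    Complex.norm_real, Real.norm_of_nonneg hc.le] at hlim
  rw [hhc, ofReal_re]
  refine le_of_sq_le_sq ?_ hc.le
  refine le_of_mul_le_mul_right ?_ hc
  linarith [show c ^ 2 * c = c ^ 3 by ring]
end

section
/- For every r ∈ [0, 1), min{ G(r), H(r) } < 5.7, where G(r) = (16π²/27) · (1 − r²)² (1 + r⁴) / (1 + r²)⁴ and H(r) = (π²/2) · (1 − r²)⁴ / ( (1 + r²)⁴ (1 − (4/π) arctan r)² ). -/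
open Real Set

/-- Hall-type bound `G(r) = (16π²/27)(1 − r²)²(1 + r⁴)/(1 + r²)⁴`. -/
noncomputable def GBound (r : ℝ) : ℝ :=
  16 * Real.pi ^ 2 / 27 * ((1 - r ^ 2) ^ 2 * (1 + r ^ 4)) / (1 + r ^ 2) ^ 4

/-- Schwarz-lemma-type bound
`H(r) = (π²/2)(1 − r²)⁴/((1 + r²)⁴(1 − (4/π) arctan r)²)`. -/
noncomputable def HBound (r : ℝ) : ℝ :=
  Real.pi ^ 2 / 2 * (1 - r ^ 2) ^ 4 /
    ((1 + r ^ 2) ^ 4 * (1 - 4 / Real.pi * Real.arctan r) ^ 2)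

theorem GBound_lt {r : ℝ} (hr : 0.067 ≤ r) (hr1 : r ≤ 1) : GBound r < 5.7 := by
  have hs : (0.004489 : ℝ) ≤ r ^ 2 := by nlinarith
  have hs1 : r ^ 2 ≤ 1 := by nlinarith
  have hpi : 16 * π ^ 2 / 27 < 5.84867 := by nlinarith [pi_lt_d6, pi_pos]
  rw [GBound, div_lt_iff₀ (by positivity), show r ^ 4 = (r ^ 2) ^ 2 by ring]
  generalize r ^ 2 = s at hs hs1 ⊢
  have hs0 : 0 ≤ s := by linarith
  calc 16 * π ^ 2 / 27 * ((1 - s) ^ 2 * (1 + s ^ 2))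
      ≤ 5.84867 * ((1 - s) ^ 2 * (1 + s ^ 2)) := by gcongr
    _ < 5.7 * (1 + s) ^ 4 := by
      nlinarith [pow_nonneg hs0 2, pow_nonneg hs0 3,
        mul_nonneg (pow_nonneg hs0 3) (sub_nonneg.2 hs1)]

theorem arctan_le_self {r : ℝ} (hr : 0 ≤ r) : arctan r ≤ r := by
  have h := le_tan (arctan_nonneg.2 hr) (arctan_lt_pi_div_two r)
  rwa [tan_arctan] at h

theorem HBound_lt {r : ℝ} (h0 : 0 ≤ r) (hr : r ≤ 0.067) : HBound r < 5.7 := by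
  have hpi0 := pi_gt_d6
  have hpi1 := pi_lt_d6
  have hsq : π ^ 2 < 9.8697 := by nlinarith
  have hs : r ^ 2 ≤ 0.067 * r := by nlinarith
  have hmain : π ^ 2 * (1 - r ^ 2) ^ 2 < 3.376 * (1 + r ^ 2) ^ 2 * (π - 4 * r) := by
    calc π ^ 2 * (1 - r ^ 2) ^ 2 ≤ 9.8697 * (1 - r ^ 2) ^ 2 := by gcongr
      _ < 3.376 * (1 + 2 * r ^ 2) * (3.141592 - 4 * r) := by
        nlinarith [mul_nonneg h0 (sub_nonneg.2 hr), mul_nonneg (sq_nonneg r) (sub_nonneg.2 hr),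
          mul_nonneg (pow_nonneg h0 3) (sub_nonneg.2 hr)]
      _ ≤ 3.376 * (1 + r ^ 2) ^ 2 * (π - 4 * r) := by
        gcongr
        · linarith
        · nlinarith [sq_nonneg (r ^ 2)]
  have hlin : π * (1 - r ^ 2) ^ 2 < 3.376 * ((1 + r ^ 2) ^ 2 * (1 - 4 / π * arctan r)) := by
    have hle : 1 - 4 / π * r ≤ 1 - 4 / π * arctan r := by
      gcongr
      exact arctan_le_self h0
    refine lt_of_lt_of_le ?_ (by gcongr :
      3.376 * ((1 + r ^ 2) ^ 2 * (1 - 4 / π * r)) ≤ _)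
    rw [← mul_lt_mul_iff_right₀ pi_pos]
    have : π * (3.376 * ((1 + r ^ 2) ^ 2 * (1 - 4 / π * r))) =
        3.376 * (1 + r ^ 2) ^ 2 * (π - 4 * r) := by field_simp
    rw [this]
    linarith
  have hpos : 0 < (1 + r ^ 2) ^ 2 * (1 - 4 / π * arctan r) := by
    have : 0 ≤ π * (1 - r ^ 2) ^ 2 := by positivity
    linarith
  have hfact : (1 + r ^ 2) ^ 4 * (1 - 4 / π * arctan r) ^ 2 =
      ((1 + r ^ 2) ^ 2 * (1 - 4 / π * arctan r)) ^ 2 := by ring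
  rw [HBound, hfact, div_lt_iff₀ (by positivity)]
  have hsquare := pow_lt_pow_left₀ hlin (by positivity) two_ne_zero
  rw [mul_pow, mul_pow] at hsquare
  nlinarith [sq_nonneg ((1 + r ^ 2) ^ 2 * (1 - 4 / π * arctan r))]

/-- For every `r ∈ [0,1)`, `min(G(r), H(r)) < 5.7`. -/
theorem min_GBound_HBound_lt :
    ∀ r ∈ Set.Ico (0 : ℝ) 1, min (GBound r) (HBound r) < 5.7 := by
  intro r hr
  rcases le_total r 0.067 with h | h
  · exact min_lt_of_right_lt (HBound_lt hr.1 h)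
  · exact min_lt_of_left_lt (GBound_lt h hr.2.le)
end

section
/- For every r ∈ [0, 1), min{ (16π²/27) · (1 + r⁴) / (1 + r²)², (π²/2) · (1 − r²)² / ( (1 + r²)² (1 − (4/π) arctan r)² ) } < 5.8. -/
open Real Set

theorem arctan_le_self_of_nonneg {x : ℝ} (hx : 0 ≤ x) : Real.arctan x ≤ x := by
  have h := Real.le_tan (Real.arctan_nonneg.2 hx) (Real.arctan_lt_pi_div_two x)
  rwa [Real.tan_arctan] at h

theorem pi_sq_lt : Real.pi ^ 2 < 9.8697 := by
  nlinarith [Real.pi_lt_d6, Real.pi_pos]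

/-- The first bound is below `5.8` away from the origin. -/
theorem first_normalized_bound_lt {r : ℝ} (hr : 0.066 ≤ r) (hr1 : r < 1) :
    16 * Real.pi ^ 2 / 27 * (1 + r ^ 4) / (1 + r ^ 2) ^ 2 < 5.8 := by
  have hs : 0.004356 ≤ r ^ 2 := by nlinarith
  have hs1 : r ^ 2 ≤ 1 := by nlinarith
  rw [div_lt_iff₀ (by positivity)]
  have h4 : 0 < 1 + r ^ 4 := by positivity
  nlinarith [mul_lt_mul_of_pos_right pi_sq_lt h4]

/-- The second bound is below `5.8` near the origin. -/
theorem second_normalized_bound_lt {r : ℝ} (hr0 : 0 ≤ r) (hr : r ≤ 0.066) :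
    Real.pi ^ 2 / 2 * (1 - r ^ 2) ^ 2 /
      ((1 + r ^ 2) ^ 2 * (1 - 4 / Real.pi * Real.arctan r) ^ 2) < 5.8 := by
  have hpi := Real.pi_gt_d4
  have hpi0 := Real.pi_pos
  have harctan := arctan_le_self_of_nonneg hr0
  set d := 1 - 4 / Real.pi * Real.arctan r with hd
  have hpd : Real.pi * d = Real.pi - 4 * Real.arctan r := by
    rw [hd]; field_simp
  have hpd' : 3.1415 - 4 * r ≤ Real.pi * d := by linarith
  have hd0 : 0 < d := by
    by_contra h
    nlinarith
  have hs : r ^ 2 ≤ 0.004356 := by nlinarith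
  have hpoly : 9.8697 * (1 - r ^ 2) < 3.4058 * ((1 + r ^ 2) * (3.1415 - 4 * r)) := by
    nlinarith [mul_nonneg hr0 (sub_nonneg.2 hr), mul_nonneg (sq_nonneg r) (sub_nonneg.2 hr)]
  have hmul : Real.pi * (Real.pi * (1 - r ^ 2)) <
      Real.pi * (3.4058 * ((1 + r ^ 2) * d)) := by
    calc Real.pi * (Real.pi * (1 - r ^ 2)) = Real.pi ^ 2 * (1 - r ^ 2) := by ring
      _ ≤ 9.8697 * (1 - r ^ 2) :=
        mul_le_mul_of_nonneg_right pi_sq_lt.le (by linarith)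
      _ < 3.4058 * ((1 + r ^ 2) * (3.1415 - 4 * r)) := hpoly
      _ ≤ 3.4058 * ((1 + r ^ 2) * (Real.pi * d)) := by gcongr
      _ = Real.pi * (3.4058 * ((1 + r ^ 2) * d)) := by ring
  have hlt := lt_of_mul_lt_mul_left hmul hpi0.le
  have hsq := pow_lt_pow_left₀ hlt
    (mul_nonneg hpi0.le (by linarith)) two_ne_zero
  have hpos : 0 < (1 + r ^ 2) ^ 2 * d ^ 2 := by positivity
  rw [div_lt_iff₀ hpos]
  simp only [mul_pow] at hsq
  linarith

/-- For every `r ∈ [0,1)`,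
`min((16π²/27)(1 + r⁴)/(1 + r²)², (π²/2)(1 − r²)²/((1 + r²)²(1 − (4/π) arctan r)²)) < 5.8`. -/
theorem min_normalized_bounds_lt :
    ∀ r ∈ Set.Ico (0 : ℝ) 1,
      min (16 * Real.pi ^ 2 / 27 * (1 + r ^ 4) / (1 + r ^ 2) ^ 2)
        (Real.pi ^ 2 / 2 * (1 - r ^ 2) ^ 2 /
          ((1 + r ^ 2) ^ 2 * (1 - 4 / Real.pi * Real.arctan r) ^ 2)) < 5.8 := by
  rintro r ⟨hr0, hr1⟩
  rcases le_total r 0.066 with h | h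
  · exact min_lt_of_right_lt (second_normalized_bound_lt hr0 h)
  · exact min_lt_of_left_lt (first_normalized_bound_lt h hr1)
end

section
/- Let t₀ = 2·arctan(√((√5 − 1)/2)). Then √(cos t₀) · sin t₀ = 2 sin³(t₀/2), and for every t ∈ (t₀, π/2), √(cos t) · sin t < 2 sin³(t/2); equivalently, z₀(t) = tan( (π/8) · √(cos t) · sin t / sin³(t/2) ) satisfies z₀(t₀) = 1 and 0 < z₀(t) < 1 for t ∈ (t₀, π/2). -/
open Real Set

/-- `z₀(t) = tan((π/8)·√(cos t)·sin t / sin³(t/2))`. -/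
noncomputable def z0 (t : ℝ) : ℝ :=
  Real.tan (Real.pi / 8 * Real.sqrt (Real.cos t) * Real.sin t / Real.sin (t / 2) ^ 3)

/-- The golden ratio conjugate `(√5 − 1)/2` is the positive root of `x² + x = 1`. -/
lemma golden_sq_add_self : ((√5 - 1) / 2) ^ 2 + (√5 - 1) / 2 = 1 := by
  have h : √5 ^ 2 = 5 := Real.sq_sqrt (by norm_num)
  linear_combination h / 4

lemma half_lt_golden : 1 / 2 < (√5 - 1) / 2 := by
  have h : 2 < √5 := Real.lt_sqrt_of_sq_lt (by norm_num)
  linarith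

lemma t0_pos : 0 < t0 := by
  have h := half_lt_golden
  have : 0 < arctan (√((√5 - 1) / 2)) := arctan_pos.2 (sqrt_pos.2 (by linarith))
  unfold t0
  linarith

lemma t0_lt_pi : t0 < π := by
  have h := arctan_lt_pi_div_two (√((√5 - 1) / 2))
  unfold t0
  linarith

lemma cos_sq_half_t0 : cos (t0 / 2) ^ 2 = (√5 - 1) / 2 := by
  have h := half_lt_golden
  have hx := golden_sq_add_self
  have ht : t0 / 2 = arctan (√((√5 - 1) / 2)) := by unfold t0; ring
  rw [ht, cos_sq_arctan, Real.sq_sqrt (by linarith), div_eq_iff (by linarith)]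
  linear_combination -hx

lemma cos_eq_two_mul_cos_half_sq (t : ℝ) : cos t = 2 * cos (t / 2) ^ 2 - 1 := by
  rw [← cos_two_mul, mul_div_cancel₀ t two_ne_zero]

lemma sin_eq_two_mul_sin_half_mul_cos_half (t : ℝ) :
    sin t = 2 * sin (t / 2) * cos (t / 2) := by
  rw [← sin_two_mul, mul_div_cancel₀ t two_ne_zero]

/-- The squares of the two sides of the inequality (after dividing by `2 sin (t/2)`) differ by
`C² + C − 1`, where `C = cos² (t/2)`. -/
lemma sqrt_cos_mul_cos_half_sq {t : ℝ} (ht : 0 ≤ cos t) :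
    (√(cos t) * cos (t / 2)) ^ 2 =
      (sin (t / 2) ^ 2) ^ 2 + ((cos (t / 2) ^ 2) ^ 2 + cos (t / 2) ^ 2 - 1) := by
  rw [mul_pow, Real.sq_sqrt ht, cos_eq_two_mul_cos_half_sq t, sin_sq]
  ring

lemma sqrt_cos_mul_sin_t0 : √(cos t0) * sin t0 = 2 * sin (t0 / 2) ^ 3 := by
  have hcos : 0 ≤ cos t0 := by
    rw [cos_eq_two_mul_cos_half_sq, cos_sq_half_t0]
    linarith [half_lt_golden]
  have hc : 0 ≤ cos (t0 / 2) :=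
    cos_nonneg_of_neg_pi_div_two_le_of_le (by linarith [t0_pos, pi_pos]) (by linarith [t0_lt_pi])
  have key : √(cos t0) * cos (t0 / 2) = sin (t0 / 2) ^ 2 := by
    rw [← sq_eq_sq₀ (by positivity) (by positivity), sqrt_cos_mul_cos_half_sq hcos,
      cos_sq_half_t0, golden_sq_add_self]
    ring
  rw [sin_eq_two_mul_sin_half_mul_cos_half t0]
  linear_combination 2 * sin (t0 / 2) * key

lemma sqrt_cos_mul_sin_lt {t : ℝ} (ht : t ∈ Ioo t0 (π / 2)) :
    √(cos t) * sin t < 2 * sin (t / 2) ^ 3 := by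
  obtain ⟨h0, h1⟩ := ht
  have hpos := t0_pos
  have hcos : 0 ≤ cos t := cos_nonneg_of_neg_pi_div_two_le_of_le (by linarith) h1.le
  have hc : 0 ≤ cos (t / 2) :=
    cos_nonneg_of_neg_pi_div_two_le_of_le (by linarith) (by linarith)
  have hs : 0 < sin (t / 2) := sin_pos_of_pos_of_lt_pi (by linarith) (by linarith)
  have hlt : cos (t / 2) ^ 2 < (√5 - 1) / 2 := by
    rw [← cos_sq_half_t0]
    have : cos (t / 2) < cos (t0 / 2) :=
      cos_lt_cos_of_nonneg_of_le_pi (by linarith) (by linarith) (by linarith)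
    gcongr
  have key : √(cos t) * cos (t / 2) < sin (t / 2) ^ 2 := by
    refine lt_of_pow_lt_pow_left₀ 2 (by positivity) ?_
    have : (cos (t / 2) ^ 2) ^ 2 < ((√5 - 1) / 2) ^ 2 := by gcongr
    rw [sqrt_cos_mul_cos_half_sq hcos]
    linarith [golden_sq_add_self]
  calc √(cos t) * sin t = 2 * sin (t / 2) * (√(cos t) * cos (t / 2)) := by
        rw [sin_eq_two_mul_sin_half_mul_cos_half t]; ring
    _ < 2 * sin (t / 2) * sin (t / 2) ^ 2 := by gcongr
    _ = 2 * sin (t / 2) ^ 3 := by ring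

lemma z0_t0 : z0 t0 = 1 := by
  have hs : sin (t0 / 2) ≠ 0 :=
    (sin_pos_of_pos_of_lt_pi (by linarith [t0_pos]) (by linarith [t0_lt_pi, t0_pos])).ne'
  rw [z0, mul_assoc, sqrt_cos_mul_sin_t0, ← tan_pi_div_four]
  congr 1
  field_simp
  norm_num

lemma z0_mem_Ioo {t : ℝ} (ht : t ∈ Ioo t0 (π / 2)) : z0 t ∈ Ioo 0 1 := by
  have hlt := sqrt_cos_mul_sin_lt ht
  obtain ⟨h0, h1⟩ := ht
  have hpos := t0_pos
  have hcos : 0 < cos t := cos_pos_of_mem_Ioo ⟨by linarith, h1⟩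
  have hsin : 0 < sin t := sin_pos_of_pos_of_lt_pi (by linarith) (by linarith)
  have hs : 0 < sin (t / 2) := sin_pos_of_pos_of_lt_pi (by linarith) (by linarith)
  have harg : 0 < π / 8 * √(cos t) * sin t / sin (t / 2) ^ 3 := by positivity
  have harg_lt : π / 8 * √(cos t) * sin t / sin (t / 2) ^ 3 < π / 4 := by
    rw [div_lt_iff₀ (by positivity)]
    calc π / 8 * √(cos t) * sin t = π / 8 * (√(cos t) * sin t) := by ring
      _ < π / 8 * (2 * sin (t / 2) ^ 3) := by gcongr
      _ = π / 4 * sin (t / 2) ^ 3 := by ring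
  refine ⟨tan_pos_of_pos_of_lt_pi_div_two harg (by linarith), ?_⟩
  rw [z0, ← tan_pi_div_four]
  exact tan_lt_tan_of_lt_of_lt_pi_div_two (by linarith) (by linarith) harg_lt

/-- **Location of the preimage of the origin.**  At `t₀` one has
`√(cos t₀)·sin t₀ = 2 sin³(t₀/2)` (equivalently `z₀(t₀) = 1`), and for
`t ∈ (t₀, π/2)` one has `√(cos t)·sin t < 2 sin³(t/2)` (equivalently `0 < z₀(t) < 1`). -/
theorem z0_eq_one_and_mem_unit_interval :
    Real.sqrt (Real.cos t0) * Real.sin t0 = 2 * Real.sin (t0 / 2) ^ 3 ∧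
    (∀ t ∈ Set.Ioo t0 (Real.pi / 2),
      Real.sqrt (Real.cos t) * Real.sin t < 2 * Real.sin (t / 2) ^ 3) ∧
    z0 t0 = 1 ∧
    (∀ t ∈ Set.Ioo t0 (Real.pi / 2), 0 < z0 t ∧ z0 t < 1) := by
  exact ⟨sqrt_cos_mul_sin_t0, fun _ ht => sqrt_cos_mul_sin_lt ht,
    z0_t0, fun _ ht => z0_mem_Ioo ht⟩
end
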